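/- Let α ≥ 0, let n ≥ 1 be an integer, let B be the open unit disc of ℝ², and let β > 0 satisfy z_1(β) = z_2(0). Assume n < (2+α)β/2. Let (U_p)_{p∈(1,p_0)} be a family of least energy n-invariant nodal solutions of the Hénon problem. Then there exists p̄ ∈ (1, p_0] such that for every p ∈ (1, p̄) the function U_p is not radial, i.e. it is not of the form x ↦ g(|x|) for any g : [0,1] → ℝ. -/

import Mathlib

open Real MeasureTheory Metric Filter Topology

noncomputable section

/-- The Euclidean plane. -/
abbrev E2 := EuclideanSpace ℝ (Fin 2)

/-- The Laplacian of `u : ℝ² → ℝ`. -/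
def lap (u : E2 → ℝ) (x : E2) : ℝ :=
  ∑ i : Fin 2, fderiv ℝ (fun y => fderiv ℝ u y (EuclideanSpace.single i 1)) x
    (EuclideanSpace.single i 1)

/-- The sup norm `‖u‖_∞` of `u` over the closed unit disc. -/
def supN (u : E2 → ℝ) : ℝ := sSup ((fun x => |u x|) '' closedBall 0 1)

/-- A classical solution of the planar Hénon problem with parameter `α` and exponent `p`. -/
def IsHenonSol (α p : ℝ) (u : E2 → ℝ) : Prop :=
  ContDiffOn ℝ 2 u (ball 0 1) ∧ ContinuousOn u (closedBall 0 1) ∧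
  (∀ x ∈ ball (0 : E2) 1, -lap u x = ‖x‖ ^ α * |u x| ^ (p - 1) * u x) ∧
  (∀ x : E2, ‖x‖ = 1 → u x = 0)

/-- Rotation of the plane by the angle `φ` about the origin. -/
def rot2 (φ : ℝ) (q : E2) : E2 :=
  (EuclideanSpace.equiv (Fin 2) ℝ).symm
    ![Real.cos φ * q 0 - Real.sin φ * q 1, Real.sin φ * q 0 + Real.cos φ * q 1]

/-- Reflection of the plane across the horizontal axis. -/
def reflX (q : E2) : E2 :=
  (EuclideanSpace.equiv (Fin 2) ℝ).symm ![q 0, -q 1]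

/-- `u` is `n`-invariant: invariant under reflection across the horizontal axis and
rotation by `2π/n`. -/
def nInvariant (n : ℕ) (u : E2 → ℝ) : Prop :=
  (∀ q : E2, u (reflX q) = u q) ∧ (∀ q : E2, u (rot2 (2 * π / n) q) = u q)

/-- The quadratic form associated with the linearization of the Hénon problem at `U`. -/
def quadForm (α p : ℝ) (U ψ : E2 → ℝ) : ℝ :=
  (∫ x in ball (0 : E2) 1, ‖fderiv ℝ ψ x‖ ^ 2) -
    p * ∫ x in ball (0 : E2) 1, ‖x‖ ^ α * |U x| ^ (p - 1) * ψ x ^ 2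

/-- The energy functional of the Hénon problem. -/
def energy (α p : ℝ) (u : E2 → ℝ) : ℝ :=
  (1 / 2) * (∫ x in ball (0 : E2) 1, ‖fderiv ℝ u x‖ ^ 2) -
    (1 / (p + 1)) * ∫ x in ball (0 : E2) 1, ‖x‖ ^ α * |u x| ^ (p + 1)

/-- An `n`-invariant Lipschitz competitor in the nodal Nehari set: it vanishes on `∂B`,
has nontrivial positive and negative parts, and both parts satisfy the Nehari constraint. -/
def IsNehariCompetitor (α p : ℝ) (n : ℕ) (v : E2 → ℝ) : Prop :=
  nInvariant n v ∧ (∃ K : NNReal, LipschitzOnWith K v (closedBall 0 1)) ∧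
  (∀ x : E2, ‖x‖ = 1 → v x = 0) ∧
  (∃ x ∈ ball (0 : E2) 1, 0 < v x) ∧ (∃ x ∈ ball (0 : E2) 1, v x < 0) ∧
  (∫ x in ball (0 : E2) 1, ‖fderiv ℝ (fun y => max (v y) 0) x‖ ^ 2)
    = (∫ x in ball (0 : E2) 1, ‖x‖ ^ α * (max (v x) 0) ^ (p + 1)) ∧
  (∫ x in ball (0 : E2) 1, ‖fderiv ℝ (fun y => max (-v y) 0) x‖ ^ 2)
    = (∫ x in ball (0 : E2) 1, ‖x‖ ^ α * (max (-v x) 0) ^ (p + 1))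

/-- A least energy `n`-invariant nodal solution of the Hénon problem:
an `n`-invariant sign-changing classical solution whose `n`-Morse index is exactly 2 and
which minimizes the energy among `n`-invariant nodal Nehari competitors. -/
def IsLeastEnergyNInvNodal (α p : ℝ) (n : ℕ) (U : E2 → ℝ) : Prop :=
  IsHenonSol α p U ∧ nInvariant n U ∧
  (∃ x ∈ ball (0 : E2) 1, 0 < U x) ∧ (∃ x ∈ ball (0 : E2) 1, U x < 0) ∧
  IsGreatest {d : ℕ | ∃ V : Submodule ℝ (E2 → ℝ), Module.finrank ℝ V = d ∧
    (∀ ψ ∈ V, ContDiff ℝ 1 ψ ∧ HasCompactSupport ψ ∧ tsupport ψ ⊆ ball 0 1 ∧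
      nInvariant n ψ) ∧
    (∀ ψ ∈ V, ψ ≠ 0 → quadForm α p U ψ < 0)} 2 ∧
  (∀ v : E2 → ℝ, IsNehariCompetitor α p n v → energy α p U ≤ energy α p v)

/-- The Bessel function of the first kind of order `β`. -/
def besselJ (β r : ℝ) : ℝ :=
  r ^ β * ∑' k : ℕ,
    ((-1 : ℝ) ^ k / (Nat.factorial k * Real.Gamma ((k : ℝ) + 1 + β))) * (r / 2) ^ (2 * k)

/-- `z` is the `i`-th positive zero of `J_β`. -/
def IsNthZero (β : ℝ) (i : ℕ) (z : ℝ) : Prop :=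
  0 < z ∧ besselJ β z = 0 ∧ {r ∈ Set.Ioo 0 z | besselJ β r = 0}.encard = ((i - 1 : ℕ) : ℕ∞)

/-- The point of the plane with polar coordinates `(r, θ)`. -/
def polar (r θ : ℝ) : E2 :=
  (EuclideanSpace.equiv (Fin 2) ℝ).symm ![r * Real.cos θ, r * Real.sin θ]

/-- The piecewise linear function which is `0` below `ε` and `1` above `2ε`. -/
def ramp (ε s : ℝ) : ℝ := max 0 (min 1 ((s - ε) / ε))

/-- A `C¹` approximation of the positive part, vanishing below `ε`. -/
def trunc (ε s : ℝ) : ℝ := ∫ σ in (0 : ℝ)..s, ramp ε σ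

/-- The primitive of the square of the derivative of `trunc`. -/
def truncSq (ε s : ℝ) : ℝ := ∫ σ in (0 : ℝ)..s, ramp ε σ ^ 2

lemma continuous_ramp (ε : ℝ) : Continuous (ramp ε) := by
  unfold ramp
  fun_prop

lemma ramp_nonneg (ε s : ℝ) : 0 ≤ ramp ε s := le_max_left _ _

lemma ramp_le_one (ε s : ℝ) : ramp ε s ≤ 1 :=
  max_le zero_le_one (min_le_left _ _)

lemma ramp_of_le {ε s : ℝ} (hε : 0 < ε) (hs : s ≤ ε) : ramp ε s = 0 :=
  max_eq_left ((min_le_right _ _).trans (div_nonpos_of_nonpos_of_nonneg (by linarith) hε.le))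

lemma ramp_of_ge {ε s : ℝ} (hε : 0 < ε) (hs : 2 * ε ≤ s) : ramp ε s = 1 := by
  have : 1 ≤ (s - ε) / ε := by rw [le_div_iff₀ hε]; linarith
  simp [ramp, min_eq_left this]

lemma hasDerivAt_trunc (ε s : ℝ) : HasDerivAt (trunc ε) (ramp ε s) s :=
  (continuous_ramp ε).integral_hasStrictDerivAt 0 s |>.hasDerivAt

lemma hasDerivAt_truncSq (ε s : ℝ) : HasDerivAt (truncSq ε) (ramp ε s ^ 2) s :=
  ((continuous_ramp ε).pow 2).integral_hasStrictDerivAt 0 s |>.hasDerivAt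

lemma contDiff_trunc (ε : ℝ) : ContDiff ℝ 1 (trunc ε) := by
  refine contDiff_one_iff_deriv.2 ⟨fun s => (hasDerivAt_trunc ε s).differentiableAt, ?_⟩
  rw [show deriv (trunc ε) = ramp ε from funext fun s => (hasDerivAt_trunc ε s).deriv]
  exact continuous_ramp ε

lemma continuous_truncSq (ε : ℝ) : Continuous (truncSq ε) :=
  continuous_iff_continuousAt.2 fun s => (hasDerivAt_truncSq ε s).continuousAt

lemma trunc_of_le {ε s : ℝ} (hε : 0 < ε) (hs : s ≤ ε) : trunc ε s = 0 := by
  refine intervalIntegral.integral_zero_ae (.of_forall fun σ hσ => ?_)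
  exact ramp_of_le hε (hσ.2.trans (max_le hε.le hs))

lemma truncSq_of_le {ε s : ℝ} (hε : 0 < ε) (hs : s ≤ ε) : truncSq ε s = 0 := by
  refine intervalIntegral.integral_zero_ae (.of_forall fun σ hσ => ?_)
  simp [ramp_of_le hε (hσ.2.trans (max_le hε.le hs))]

lemma trunc_nonneg {ε : ℝ} (hε : 0 < ε) (s : ℝ) : 0 ≤ trunc ε s := by
  rcases le_total s ε with h | h
  · exact (trunc_of_le hε h).ge
  · exact intervalIntegral.integral_nonneg (hε.le.trans h) fun σ _ => ramp_nonneg ε σ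

lemma truncSq_le {ε s : ℝ} (hs : 0 ≤ s) : truncSq ε s ≤ s := by
  have := intervalIntegral.integral_mono_on (μ := volume) hs
    (((continuous_ramp ε).pow 2).intervalIntegrable 0 s)
    (intervalIntegrable_const (c := (1 : ℝ)))
    (fun σ _ => pow_le_one₀ (ramp_nonneg ε σ) (ramp_le_one ε σ))
  simpa [truncSq] using this

lemma sub_two_mul_le_trunc {ε : ℝ} (hε : 0 < ε) (s : ℝ) : s - 2 * ε ≤ trunc ε s := by
  rcases le_total s (2 * ε) with h | h
  · linarith [trunc_nonneg hε s]
  · have h1 : trunc ε s = trunc ε (2 * ε) + ∫ σ in (2 * ε)..s, ramp ε σ :=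
      (intervalIntegral.integral_add_adjacent_intervals
        ((continuous_ramp ε).intervalIntegrable _ _)
        ((continuous_ramp ε).intervalIntegrable _ _)).symm
    have h2 : ∫ σ in (2 * ε)..s, ramp ε σ = ∫ σ in (2 * ε)..s, (1 : ℝ) :=
      intervalIntegral.integral_congr fun σ hσ => by
        rw [Set.uIcc_of_le h] at hσ
        exact ramp_of_ge hε hσ.1
    rw [h1, h2]
    simp only [intervalIntegral.integral_const, smul_eq_mul, mul_one]
    linarith [trunc_nonneg hε (2 * ε)]

lemma trunc_sq_le {ε : ℝ} (hε : 0 < ε) (s : ℝ) : trunc ε s ^ 2 ≤ s * truncSq ε s := by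
  rcases le_or_gt s ε with h | h
  · simp [trunc_of_le hε h, truncSq_of_le hε h]
  have hs : 0 < s := hε.trans h
  set q := trunc ε s / s with hq
  have hc := continuous_ramp ε
  have h0 : 0 ≤ ∫ σ in (0 : ℝ)..s, (ramp ε σ - q) ^ 2 :=
    intervalIntegral.integral_nonneg hs.le fun σ _ => sq_nonneg _
  have h1 : ∫ σ in (0 : ℝ)..s, (ramp ε σ - q) ^ 2
      = truncSq ε s - 2 * q * trunc ε s + q ^ 2 * s := by
    have : ∀ σ, (ramp ε σ - q) ^ 2 = ramp ε σ ^ 2 - 2 * q * ramp ε σ + q ^ 2 := fun σ => by ring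
    simp_rw [this]
    rw [intervalIntegral.integral_add, intervalIntegral.integral_sub,
      intervalIntegral.integral_const_mul]
    · simp [trunc, truncSq]; ring
    all_goals exact Continuous.intervalIntegrable (by fun_prop) _ _
  have h2 : q * s = trunc ε s := by rw [hq]; field_simp
  have h3 : s * (truncSq ε s - 2 * q * trunc ε s + q ^ 2 * s)
      = s * truncSq ε s - trunc ε s ^ 2 := by rw [← h2]; ring
  have := mul_nonneg hs.le (h1 ▸ h0)
  linarith

lemma mul_truncSq_sub_trunc_sq_le {ε : ℝ} (hε : 0 < ε) (s : ℝ) :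
    s * truncSq ε s - trunc ε s ^ 2 ≤ 4 * ε * |s| := by
  rcases le_or_gt s ε with h | h
  · simp only [trunc_of_le hε h, truncSq_of_le hε h]
    have := abs_nonneg s
    ring_nf
    positivity
  have hs : 0 < s := hε.trans h
  rw [abs_of_pos hs]
  have h1 := mul_le_mul_of_nonneg_left (truncSq_le (ε := ε) hs.le) hs.le
  have h2 := sub_two_mul_le_trunc hε s
  rcases le_total s (2 * ε) with h3 | h3
  · nlinarith [sq_nonneg (trunc ε s)]
  · nlinarith

/-- Testing the equation `(t y')' = -A y` with `truncSq ε y`. -/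
lemma integral_ramp_mul_deriv_sq {y D A : ℝ → ℝ} {a b ε : ℝ} (hε : 0 < ε) (hab : a ≤ b)
    (hyc : ContinuousOn y (Set.Icc a b)) (hD : ContinuousOn D (Set.Icc a b))
    (hA : ContinuousOn A (Set.Icc a b))
    (hy : ∀ t ∈ Set.Ioo a b, HasDerivAt y (D t) t)
    (hm : ∀ t ∈ Set.Ioo a b, HasDerivAt (fun t => t * D t) (-(A t * y t)) t)
    (ha : a * D a = 0 ∨ y a ≤ ε) (hb : y b ≤ ε) :
    ∫ t in a..b, t * (ramp ε (y t) * D t) ^ 2 = ∫ t in a..b, A t * (y t * truncSq ε (y t)) := by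
  have hr := (continuous_ramp ε).comp_continuousOn hyc
  have hk := (continuous_truncSq ε).comp_continuousOn hyc
  have hi : ∀ f : ℝ → ℝ, ContinuousOn f (Set.Icc a b) → IntervalIntegrable f volume a b :=
    fun f hf => ContinuousOn.intervalIntegrable (by rwa [Set.uIcc_of_le hab])
  have hi1 := hi (fun t => t * (ramp ε (y t) * D t) ^ 2) (continuousOn_id.mul ((hr.mul hD).pow 2))
  have hi2 := hi (fun t => A t * (y t * truncSq ε (y t))) (hA.mul (hyc.mul hk))
  have key := intervalIntegral.integral_eq_sub_of_hasDerivAt_of_le (E := ℝ) hab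
    (f := fun t => truncSq ε (y t) * (t * D t))
    (f' := fun t => t * (ramp ε (y t) * D t) ^ 2 - A t * (y t * truncSq ε (y t)))
    (hk.mul (continuousOn_id.mul hD))
    (fun t ht => (((hasDerivAt_truncSq ε (y t)).comp t (hy t ht)).mul (hm t ht)).congr_deriv
      (by simp only [Function.comp]; ring))
    (hi1.sub hi2)
  rw [intervalIntegral.integral_sub hi1 hi2] at key
  have h1 : truncSq ε (y a) * (a * D a) = 0 := by
    rcases ha with h | h
    · rw [h, mul_zero]
    · rw [truncSq_of_le hε h, zero_mul]
  rw [truncSq_of_le hε hb, h1] at key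
  linarith

/-- If `(t y')' = -A y`, then increasing the potential from `A` to `A + W` makes
suitable truncations of `y` negative directions. -/
lemma exists_trunc_integral_neg {y D A W : ℝ → ℝ} {R C κ a₀ b₀ : ℝ} (hκ : 0 < κ) (ha₀ : 0 ≤ a₀)
    (hab₀ : a₀ < b₀) (hb₀ : b₀ < R)
    (hyκ : ∀ t ∈ Set.Icc a₀ b₀, 3 * κ ≤ y t)
    (hAC : ∀ t ∈ Set.Ico 0 R, A t ≤ C) (hyC : ∀ t ∈ Set.Ico 0 R, |y t| ≤ C)
    (hW : ∀ t ∈ Set.Ico 0 R, 0 ≤ W t) (hW₀ : ∀ t ∈ Set.Ioc a₀ b₀, 0 < W t)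
    (hWc : ContinuousOn W (Set.Icc a₀ b₀)) :
    ∃ ε : ℝ, 0 < ε ∧ ∀ a b, 0 ≤ a → a ≤ a₀ → b₀ ≤ b → b < R →
      ContinuousOn y (Set.Icc a b) → ContinuousOn D (Set.Icc a b) →
      ContinuousOn A (Set.Icc a b) → ContinuousOn W (Set.Icc a b) →
      (∀ t ∈ Set.Ioo a b, HasDerivAt y (D t) t) →
      (∀ t ∈ Set.Ioo a b, HasDerivAt (fun t => t * D t) (-(A t * y t)) t) →
      (a * D a = 0 ∨ y a ≤ ε) → y b ≤ ε →
      ∫ t in a..b, (t * (ramp ε (y t) * D t) ^ 2 - (A t + W t) * trunc ε (y t) ^ 2) < 0 := by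
  have hC : 0 ≤ C := (abs_nonneg _).trans (hyC a₀ ⟨ha₀, hab₀.trans hb₀⟩)
  have hR : 0 < R := by linarith
  set I := ∫ t in a₀..b₀, W t with hI
  have hIpos : 0 < I := by
    refine intervalIntegral.intervalIntegral_pos_of_pos_on
      (ContinuousOn.intervalIntegrable (by rwa [Set.uIcc_of_le hab₀.le]))
      (fun t ht => hW₀ t ⟨ht.1, ht.2.le⟩) hab₀
  obtain ⟨ε₁, hε₁, hε₁'⟩ : ∃ ε₁ : ℝ, 0 < ε₁ ∧ 4 * ε₁ * C * C * R < κ ^ 2 * I := by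
    refine ⟨κ ^ 2 * I / (4 * C * C * R + 1) / 1, by positivity, ?_⟩
    have h0 : 0 < κ ^ 2 * I := by positivity
    have h1 : 0 ≤ 4 * C * C * R := by positivity
    rw [div_one, show 4 * (κ ^ 2 * I / (4 * C * C * R + 1)) * C * C * R
      = κ ^ 2 * I * (4 * C * C * R) / (4 * C * C * R + 1) by ring, div_lt_iff₀ (by linarith)]
    nlinarith
  refine ⟨min ε₁ κ, lt_min hε₁ hκ, ?_⟩
  set ε := min ε₁ κ with hε
  have hε0 : 0 < ε := lt_min hε₁ hκ
  intro a b ha haa₀ hb₀b hbR hyc hDc hAc hWc' hy hm hya hyb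
  have hab : a < b := by linarith
  have hr := (continuous_ramp ε).comp_continuousOn hyc
  have hk := (continuous_truncSq ε).comp_continuousOn hyc
  have hh := (contDiff_trunc ε).continuous.comp_continuousOn hyc
  have hi : ∀ f : ℝ → ℝ, ContinuousOn f (Set.Icc a b) → IntervalIntegrable f volume a b :=
    fun f hf => ContinuousOn.intervalIntegrable (by rwa [Set.uIcc_of_le hab.le])
  have hi1 := hi (fun t => t * (ramp ε (y t) * D t) ^ 2) (continuousOn_id.mul ((hr.mul hDc).pow 2))
  have hi2 := hi (fun t => (A t + W t) * trunc ε (y t) ^ 2) ((hAc.add hWc').mul (hh.pow 2))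
  have hi3 := hi (fun t => A t * (y t * truncSq ε (y t))) (hAc.mul (hyc.mul hk))
  have hi4 := hi (fun t => W t * trunc ε (y t) ^ 2) (hWc'.mul (hh.pow 2))
  rw [intervalIntegral.integral_sub hi1 hi2,
    integral_ramp_mul_deriv_sq hε0 hab.le hyc hDc hAc hy hm hya hyb,
    ← intervalIntegral.integral_sub hi3 hi2]
  have hle : ∫ t in a..b, (A t * (y t * truncSq ε (y t)) - (A t + W t) * trunc ε (y t) ^ 2)
      ≤ ∫ t in a..b, (4 * ε * C * C - W t * trunc ε (y t) ^ 2) := by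
    refine intervalIntegral.integral_mono_on hab.le (hi3.sub hi2)
      (intervalIntegrable_const.sub hi4) fun t ht => ?_
    have htR : t ∈ Set.Ico 0 R := ⟨ha.trans ht.1, ht.2.trans_lt hbR⟩
    have h1 := mul_truncSq_sub_trunc_sq_le hε0 (y t)
    have h2 := trunc_sq_le hε0 (y t)
    have h3 : A t * (y t * truncSq ε (y t) - trunc ε (y t) ^ 2)
        ≤ C * (y t * truncSq ε (y t) - trunc ε (y t) ^ 2) :=
      mul_le_mul_of_nonneg_right (hAC t htR) (by linarith)
    have h4 := mul_le_mul_of_nonneg_left (h1.trans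
      (mul_le_mul_of_nonneg_left (hyC t htR) (by positivity))) hC
    linarith
  have hlow : κ ^ 2 * I ≤ ∫ t in a..b, W t * trunc ε (y t) ^ 2 := by
    have h1 : ∫ t in a₀..b₀, W t * trunc ε (y t) ^ 2 ≤ ∫ t in a..b, W t * trunc ε (y t) ^ 2 := by
      refine intervalIntegral.integral_mono_interval haa₀ hab₀.le hb₀b ?_ hi4
      refine (ae_restrict_iff' measurableSet_Ioc).2 (.of_forall fun t ht => ?_)
      exact mul_nonneg (hW t ⟨by linarith [ht.1], by linarith [ht.2]⟩) (sq_nonneg _)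
    refine le_trans ?_ h1
    rw [hI, ← intervalIntegral.integral_const_mul]
    have hs : Set.Icc a₀ b₀ ⊆ Set.Icc a b := Set.Icc_subset_Icc haa₀ hb₀b
    refine intervalIntegral.integral_mono_on hab₀.le
      ((ContinuousOn.intervalIntegrable (by rwa [Set.uIcc_of_le hab₀.le])).const_mul _)
      (ContinuousOn.intervalIntegrable (by
        rw [Set.uIcc_of_le hab₀.le]
        exact (hWc'.mul (hh.pow 2)).mono hs)) fun t ht => ?_
    have h2 := sub_two_mul_le_trunc hε0 (y t)
    have h3 : κ ≤ trunc ε (y t) := by linarith [hyκ t ht, min_le_right ε₁ κ]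
    rw [mul_comm]
    exact mul_le_mul_of_nonneg_left (pow_le_pow_left₀ hκ.le h3 2)
      (hW t ⟨ha₀.trans ht.1, ht.2.trans_lt hb₀⟩)
  rw [intervalIntegral.integral_sub intervalIntegrable_const hi4] at hle
  simp only [intervalIntegral.integral_const, smul_eq_mul] at hle
  have h5 : (b - a) * (4 * ε * C * C) ≤ 4 * ε₁ * C * C * R := by
    have h6 : 4 * ε * C * C ≤ 4 * ε₁ * C * C := by
      have := min_le_left ε₁ κ
      gcongr
    have h7 : 0 ≤ 4 * ε₁ * C * C := by positivity
    calc (b - a) * (4 * ε * C * C) ≤ R * (4 * ε₁ * C * C) :=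
          mul_le_mul (by linarith) h6 (by positivity) hR.le
      _ = _ := by ring
  linarith

/-- The entire series with `J_β(r) = r ^ β * besselF β (r ^ 2 / 4)`. -/
def besselF (β x : ℝ) : ℝ :=
  ∑' k : ℕ, ((-1 : ℝ) ^ k / (Nat.factorial k * Real.Gamma ((k : ℝ) + 1 + β))) * x ^ k

lemma besselJ_eq (β r : ℝ) : besselJ β r = r ^ β * besselF β (r ^ 2 / 4) := by
  have (k : ℕ) : (r ^ 2 / 4) ^ k = (r / 2) ^ (2 * k) := by
    rw [pow_mul]
    ring
  simp only [besselJ, besselF, this]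

lemma Gamma_one_add_le {β : ℝ} (hβ : 0 ≤ β) (k : ℕ) :
    Gamma (1 + β) ≤ Gamma ((k : ℝ) + 1 + β) := by
  induction k with
  | zero => simp
  | succ k ih =>
    have h : ((k + 1 : ℕ) : ℝ) + 1 + β = ((k : ℝ) + 1 + β) + 1 := by push_cast; ring
    have h0 : 0 < Gamma ((k : ℝ) + 1 + β) := Gamma_pos_of_pos (by positivity)
    rw [h, Gamma_add_one (by positivity)]
    have : (0 : ℝ) ≤ k := k.cast_nonneg
    nlinarith

lemma abs_besselF_coeff_le {β : ℝ} (hβ : 0 ≤ β) (k : ℕ) :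
    |(-1 : ℝ) ^ k / (Nat.factorial k * Gamma ((k : ℝ) + 1 + β))|
      ≤ (Gamma (1 + β))⁻¹ * (Nat.factorial k : ℝ)⁻¹ := by
  have h0 : 0 < Gamma (1 + β) := Gamma_pos_of_pos (by positivity)
  have h1 : 0 < Gamma ((k : ℝ) + 1 + β) := Gamma_pos_of_pos (by positivity)
  have hk : (0 : ℝ) < Nat.factorial k := by positivity
  rw [abs_div, abs_pow, abs_neg, abs_one, one_pow, abs_of_pos (by positivity), one_div, mul_inv,
    mul_comm]
  gcongr
  exact Gamma_one_add_le hβ k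

lemma summable_besselF {β : ℝ} (hβ : 0 ≤ β) (x : ℝ) :
    Summable fun k : ℕ =>
      ((-1 : ℝ) ^ k / (Nat.factorial k * Gamma ((k : ℝ) + 1 + β))) * x ^ k := by
  refine Summable.of_norm_bounded
    ((Real.summable_pow_div_factorial |x|).mul_left (Gamma (1 + β))⁻¹) fun k => ?_
  rw [norm_mul, norm_pow, Real.norm_eq_abs, Real.norm_eq_abs]
  calc _ ≤ (Gamma (1 + β))⁻¹ * (Nat.factorial k : ℝ)⁻¹ * |x| ^ k := by
        gcongr
        exact abs_besselF_coeff_le hβ k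
    _ = _ := by ring

lemma besselF_coeff_succ {β : ℝ} (k : ℕ) :
    (-1 : ℝ) ^ (k + 1) / (Nat.factorial (k + 1) * Gamma (((k + 1 : ℕ) : ℝ) + 1 + β)) * (k + 1)
      = -((-1 : ℝ) ^ k / (Nat.factorial k * Gamma ((k : ℝ) + 1 + (β + 1)))) := by
  have h : ((k + 1 : ℕ) : ℝ) + 1 + β = (k : ℝ) + 1 + (β + 1) := by push_cast; ring
  rw [h, Nat.factorial_succ, pow_succ]
  push_cast
  have : (k : ℝ) + 1 ≠ 0 := by positivity
  have hk : (Nat.factorial k : ℝ) ≠ 0 := by positivity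
  rw [mul_assoc ((k : ℝ) + 1), div_mul_eq_mul_div, mul_comm _ ((k : ℝ) + 1),
    mul_div_mul_left _ _ this, mul_neg_one, neg_div]

lemma hasDerivAt_besselF {β : ℝ} (hβ : 0 ≤ β) (x : ℝ) :
    HasDerivAt (besselF β) (-besselF (β + 1) x) x := by
  set a : ℕ → ℝ := fun k => (-1 : ℝ) ^ k / (Nat.factorial k * Gamma ((k : ℝ) + 1 + β)) with ha
  set R := |x| + 1
  have hR : 0 < R := by positivity
  have hG : 0 ≤ (Gamma (1 + β))⁻¹ := inv_nonneg.2 (Gamma_pos_of_pos (by positivity)).le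
  have hbound : ∀ k : ℕ, ∀ y ∈ ball (0 : ℝ) R, ‖a k * (k * y ^ (k - 1))‖
      ≤ (Gamma (1 + β))⁻¹ * (Nat.factorial k : ℝ)⁻¹ * (k * R ^ (k - 1)) := fun k y hy => by
    rw [mem_ball_zero_iff, Real.norm_eq_abs] at hy
    rw [norm_mul, norm_mul, norm_pow, Real.norm_eq_abs, Real.norm_eq_abs, Real.norm_eq_abs,
      Nat.abs_cast]
    gcongr
    exact abs_besselF_coeff_le hβ k
  have hsum : Summable fun k : ℕ =>
      (Gamma (1 + β))⁻¹ * (Nat.factorial k : ℝ)⁻¹ * (k * R ^ (k - 1)) := by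
    rw [← summable_nat_add_iff 1]
    refine ((Real.summable_pow_div_factorial R).mul_left (Gamma (1 + β))⁻¹).congr fun k => ?_
    rw [Nat.factorial_succ]
    push_cast
    have : (k : ℝ) + 1 ≠ 0 := by positivity
    have hk : (Nat.factorial k : ℝ) ≠ 0 := by positivity
    field_simp
  have hx : x ∈ ball (0 : ℝ) R := by simp [R]
  have hd := hasDerivAt_tsum_of_isPreconnected (g := fun k y => a k * y ^ k)
    (g' := fun k y => a k * (k * y ^ (k - 1))) hsum isOpen_ball
    (convex_ball (0 : ℝ) R).isPreconnected
    (fun k y _ => (hasDerivAt_pow k y).const_mul (a k)) hbound hx (summable_besselF hβ x) hx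
  refine hd.congr_deriv ?_
  have hs : Summable fun k : ℕ => a k * (k * x ^ (k - 1)) :=
    .of_norm_bounded hsum fun k => hbound k x hx
  rw [hs.tsum_eq_zero_add, besselF, ← tsum_neg]
  simp only [Nat.cast_zero, zero_mul, mul_zero, zero_add, add_tsub_cancel_right]
  refine tsum_congr fun k => ?_
  have := besselF_coeff_succ (β := β) k
  rw [← neg_mul, ← this, ha]
  push_cast
  ring

lemma besselF_recurrence {β : ℝ} (hβ : 0 ≤ β) (x : ℝ) :
    besselF β x = (1 + β) * besselF (β + 1) x - x * besselF (β + 1 + 1) x := by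
  have h1 := summable_besselF (β := β + 1) (by linarith) x
  have h2 := (summable_besselF (β := β + 1 + 1) (by linarith) x).mul_left x
  have h3 : Summable fun k : ℕ => (k : ℝ) *
      ((-1 : ℝ) ^ k / (Nat.factorial k * Gamma ((k : ℝ) + 1 + (β + 1))) * x ^ k) := by
    rw [← summable_nat_add_iff 1]
    refine h2.neg.congr fun k => ?_
    have := besselF_coeff_succ (β := β + 1) k
    rw [pow_succ x k]
    push_cast at this ⊢
    linear_combination (-x ^ k * x) * this
  have h4 : x * besselF (β + 1 + 1) x = -∑' k : ℕ, (k : ℝ) *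
      ((-1 : ℝ) ^ k / (Nat.factorial k * Gamma ((k : ℝ) + 1 + (β + 1))) * x ^ k) := by
    rw [h3.tsum_eq_zero_add, besselF, ← tsum_mul_left]
    simp only [Nat.cast_zero, zero_mul, zero_add]
    rw [← tsum_neg]
    refine tsum_congr fun k => ?_
    have := besselF_coeff_succ (β := β + 1) k
    rw [pow_succ x k]
    push_cast at this ⊢
    linear_combination (x ^ k * x) * this
  rw [h4, sub_neg_eq_add]
  conv_rhs => rw [besselF, ← tsum_mul_left]
  rw [← (h1.mul_left _).tsum_add h3, besselF]
  refine tsum_congr fun k => ?_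
  have hk : (Nat.factorial k : ℝ) ≠ 0 := by positivity
  have hpos : (0 : ℝ) < (k : ℝ) + 1 + β := by positivity
  have hG : Gamma ((k : ℝ) + 1 + β) ≠ 0 := (Gamma_pos_of_pos hpos).ne'
  rw [show (k : ℝ) + 1 + (β + 1) = ((k : ℝ) + 1 + β) + 1 by ring, Gamma_add_one hpos.ne']
  field_simp
  ring

lemma besselF_zero (β : ℝ) : besselF β 0 = (Gamma (1 + β))⁻¹ := by
  rw [besselF, tsum_eq_single 0 fun k hk => by simp [hk]]
  simp

lemma continuous_besselF {β : ℝ} (hβ : 0 ≤ β) : Continuous (besselF β) :=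
  continuous_iff_continuousAt.2 fun x => (hasDerivAt_besselF hβ x).continuousAt

/-- The derivative of `J_β` on the positive half line. -/
def besselD (β t : ℝ) : ℝ :=
  β * t ^ (β - 1) * besselF β (t ^ 2 / 4) - t ^ (β + 1) / 2 * besselF (β + 1) (t ^ 2 / 4)

lemma hasDerivAt_besselF_sq {β : ℝ} (hβ : 0 ≤ β) (t : ℝ) :
    HasDerivAt (fun t => besselF β (t ^ 2 / 4)) (-(t / 2) * besselF (β + 1) (t ^ 2 / 4)) t := by
  have h : HasDerivAt (fun t : ℝ => t ^ 2 / 4) (t / 2) t :=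
    ((hasDerivAt_pow 2 t).div_const 4).congr_deriv (by norm_num; ring)
  refine ((hasDerivAt_besselF hβ (t ^ 2 / 4)).comp t h).congr_deriv ?_
  ring

lemma hasDerivAt_besselJ {β t : ℝ} (hβ : 0 ≤ β) (ht : 0 < t) :
    HasDerivAt (besselJ β) (besselD β t) t := by
  rw [show besselJ β = fun r => r ^ β * besselF β (r ^ 2 / 4) from funext (besselJ_eq β)]
  refine ((Real.hasDerivAt_rpow_const (p := β) (Or.inl ht.ne')).mul
    (hasDerivAt_besselF_sq hβ t)).congr_deriv ?_
  rw [besselD, rpow_add_one ht.ne']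
  ring

lemma hasDerivAt_mul_besselD {β t : ℝ} (hβ : 0 ≤ β) (ht : 0 < t) :
    HasDerivAt (fun t => t * besselD β t) (-((t - β ^ 2 / t) * besselJ β t)) t := by
  have h1 : (fun t => t * besselD β t) =ᶠ[𝓝 t] fun t =>
      β * (t ^ β * besselF β (t ^ 2 / 4)) - t ^ (β + 2) / 2 * besselF (β + 1) (t ^ 2 / 4) := by
    filter_upwards [lt_mem_nhds ht] with s hs
    rw [besselD, show β + 2 = β + 1 + 1 by ring, rpow_add_one hs.ne' (β + 1),
      rpow_sub_one hs.ne']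
    field_simp
  refine HasDerivAt.congr_of_eventuallyEq ?_ h1
  have h2 := (((Real.hasDerivAt_rpow_const (x := t) (p := β) (Or.inl ht.ne')).mul
    (hasDerivAt_besselF_sq hβ t)).const_mul β).sub
    (((Real.hasDerivAt_rpow_const (x := t) (p := β + 2) (Or.inl ht.ne')).div_const 2).mul
    (hasDerivAt_besselF_sq (β := β + 1) (by linarith) t))
  refine h2.congr_deriv ?_
  rw [besselJ_eq, besselF_recurrence hβ, show β + 2 - 1 = β + 1 by ring,
    show β + 2 = β + 1 + 1 by ring, rpow_add_one ht.ne' (β + 1), rpow_add_one ht.ne',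
    rpow_sub_one ht.ne']
  field_simp
  ring

lemma continuous_besselJ {β : ℝ} (hβ : 0 ≤ β) : Continuous (besselJ β) := by
  rw [show besselJ β = fun r => r ^ β * besselF β (r ^ 2 / 4) from funext (besselJ_eq β)]
  have := continuous_besselF hβ
  exact (Real.continuous_rpow_const hβ).mul (by fun_prop)

lemma continuousOn_besselD {β : ℝ} (hβ : 0 ≤ β) : ContinuousOn (besselD β) (Set.Ioi 0) := by
  intro t ht
  have h := (hasDerivAt_mul_besselD hβ ht).continuousAt
  have h2 : ContinuousAt (fun s => s⁻¹ * (s * besselD β s)) t :=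
    (continuousAt_inv₀ (ne_of_gt ht)).mul h
  refine (h2.congr ?_).continuousWithinAt
  filter_upwards [lt_mem_nhds (show (0 : ℝ) < t from ht)] with s hs
  field_simp

lemma besselJ_zero_zero : besselJ 0 0 = 1 := by
  simp [besselJ_eq, besselF_zero]

lemma besselJ_apply_zero {β : ℝ} (hβ : 0 < β) : besselJ β 0 = 0 := by
  simp [besselJ_eq, zero_rpow hβ.ne']

lemma besselD_zero (t : ℝ) : besselD 0 t = -(t / 2 * besselF 1 (t ^ 2 / 4)) := by
  simp [besselD]

lemma continuous_besselD_zero : Continuous (besselD 0) := by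
  have := continuous_besselF zero_le_one
  rw [show besselD 0 = _ from funext besselD_zero]
  fun_prop

lemma exists_besselJ_pos {β z : ℝ} (hβ : 0 ≤ β) (hz : 0 < z) :
    ∃ t ∈ Set.Ioo 0 z, 0 < besselJ β t := by
  have h0 : 0 < besselF β (0 ^ 2 / 4) := by
    rw [show (0 : ℝ) ^ 2 / 4 = 0 by norm_num, besselF_zero]
    exact inv_pos.2 (Gamma_pos_of_pos (by linarith))
  have hc : Continuous fun t : ℝ => besselF β (t ^ 2 / 4) := by
    have := continuous_besselF hβ
    fun_prop
  have h1 : ∀ᶠ t in 𝓝[>] (0 : ℝ), 0 < besselF β (t ^ 2 / 4) :=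
    (hc.tendsto 0).eventually (lt_mem_nhds h0) |>.filter_mono nhdsWithin_le_nhds
  obtain ⟨t, ht, htz⟩ := (h1.and (Ioo_mem_nhdsGT hz)).exists
  exact ⟨t, htz, by rw [besselJ_eq]; have := htz.1; positivity⟩

/-- The only zero of `J₀` below its second zero. -/
lemma exists_unique_zero_besselJ_zero {z : ℝ} (hz : IsNthZero 0 2 z) :
    ∃ z₁ ∈ Set.Ioo 0 z, besselJ 0 z₁ = 0 ∧ ∀ t ∈ Set.Ioo 0 z, besselJ 0 t = 0 → t = z₁ := by
  obtain ⟨z₁, h⟩ := Set.encard_eq_one.1 (hz.2.2.trans (by norm_num))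
  have h1 : z₁ ∈ {r ∈ Set.Ioo 0 z | besselJ 0 r = 0} := by rw [h]; rfl
  refine ⟨z₁, h1.1, h1.2, fun t ht h0 => ?_⟩
  have h2 : t ∈ {r ∈ Set.Ioo 0 z | besselJ 0 r = 0} := ⟨ht, h0⟩
  rwa [h] at h2

/-- Zeros of `J₀` are simple. -/
lemma besselD_zero_ne_zero {z₁ : ℝ} (hz₁ : 0 < z₁) (h : besselJ 0 z₁ = 0) : besselD 0 z₁ ≠ 0 := by
  intro h'
  have hd : ∀ t : ℝ, 0 < t → HasDerivAt
      (fun t => t ^ 2 * besselJ 0 t ^ 2 + (t * besselD 0 t) ^ 2) (2 * t * besselJ 0 t ^ 2) t := by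
    intro t ht
    refine (((hasDerivAt_pow 2 t).mul ((hasDerivAt_besselJ le_rfl ht).pow 2)).add
      ((hasDerivAt_mul_besselD le_rfl ht).pow 2)).congr_deriv ?_
    simp
    ring
  have hmono : MonotoneOn (fun t => t ^ 2 * besselJ 0 t ^ 2 + (t * besselD 0 t) ^ 2)
      (Set.Ioi 0) := by
    refine monotoneOn_of_deriv_nonneg (convex_Ioi 0)
      (fun t ht => (hd t ht).continuousAt.continuousWithinAt)
      (fun t ht => (hd t (interior_subset ht)).differentiableAt.differentiableWithinAt)
      fun t ht => ?_
    have ht' : (0 : ℝ) < t := interior_subset ht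
    rw [(hd t ht').deriv]
    positivity
  obtain ⟨t, ht, hpos⟩ := exists_besselJ_pos le_rfl hz₁ (β := 0)
  have := hmono ht.1 hz₁ ht.2.le
  have ht0 := ht.1
  simp only [h, h'] at this
  have h3 : 0 < t ^ 2 * besselJ 0 t ^ 2 := by positivity
  nlinarith [sq_nonneg (t * besselD 0 t)]

lemma abs_rpow_mul_self_sub_le {p x : ℝ} (hp : 1 < p) (hx : |x| ≤ 1) :
    |(|x| ^ (p - 1) * x - x)| ≤ p - 1 := by
  rw [show |x| ^ (p - 1) * x - x = (|x| ^ (p - 1) - 1) * x by ring, abs_mul]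
  rcases eq_or_ne x 0 with rfl | h
  · simp [hp.le]
  have hpos : 0 < |x| := abs_pos.2 h
  have h1 : |x| ^ (p - 1) ≤ 1 := rpow_le_one hpos.le hx (by linarith)
  rw [abs_of_nonpos (by linarith)]
  have h2 : 1 + log |x| * (p - 1) ≤ |x| ^ (p - 1) := by
    rw [rpow_def_of_pos hpos]
    linarith [add_one_le_exp (log |x| * (p - 1))]
  have h3 : 1 - |x|⁻¹ ≤ log |x| := one_sub_inv_le_log_of_pos hpos
  have h4 : |x| * (1 - |x|⁻¹) ≤ |x| * log |x| := mul_le_mul_of_nonneg_left h3 hpos.le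
  rw [mul_sub, mul_inv_cancel₀ hpos.ne'] at h4
  have h5 : (p - 1) * (-(|x| * log |x|)) ≤ (p - 1) * 1 :=
    mul_le_mul_of_nonneg_left (by linarith) (by linarith)
  nlinarith

/-- A normalized solution of the radial equation in the rescaled variable, written as a first order
system for `W` and `V = t W'` on `(0, c)` with `W(c) = 0`. -/
structure IsRadialProfile (p c : ℝ) (W V : ℝ → ℝ) : Prop where
  pos : 0 < c
  hasDerivAt_fst : ∀ t ∈ Set.Ioo 0 c, HasDerivAt W (V t / t) t
  hasDerivAt_snd : ∀ t ∈ Set.Ioo 0 c, HasDerivAt V (-(t * (|W t| ^ (p - 1) * W t))) t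
  abs_le_one : ∀ t ∈ Set.Ioo 0 c, |W t| ≤ 1
  tendsto_fst : Tendsto W (𝓝[>] 0) (𝓝 1)
  tendsto_snd : Tendsto (fun t => V t / t) (𝓝[>] 0) (𝓝 0)
  continuousWithinAt_end : ContinuousWithinAt W (Set.Iio c) c
  eq_zero_end : W c = 0

lemma IsRadialProfile.sq_add_sq_le {p c : ℝ} {W V : ℝ → ℝ} (h : IsRadialProfile p c W V)
    (hp : 1 < p) {t : ℝ} (ht : t ∈ Set.Ioo 0 c) :
    (W t - besselJ 0 t) ^ 2 + (V t / t - besselD 0 t) ^ 2 ≤ ((p - 1) * exp t) ^ 2 := by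
  set e : ℝ → ℝ := fun t => (W t - besselJ 0 t) ^ 2 + (V t / t - besselD 0 t) ^ 2 with he
  set η : ℝ → ℝ := fun t => |W t| ^ (p - 1) * W t - W t with hη
  have hDer : ∀ t ∈ Set.Ioo 0 c, HasDerivAt e
      (2 * (V t / t - besselD 0 t) * (-η t) - 2 * (V t / t - besselD 0 t) ^ 2 / t) t := by
    intro t ht
    have ht0 : t ≠ 0 := ht.1.ne'
    have h1 := (h.hasDerivAt_fst t ht).sub (hasDerivAt_besselJ le_rfl ht.1 (β := 0))
    have h2 := ((h.hasDerivAt_snd t ht).sub (hasDerivAt_mul_besselD le_rfl ht.1 (β := 0))).div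
      (hasDerivAt_id t) ht0
    have h3 := (h1.pow 2).add (h2.pow 2)
    have heq : e =ᶠ[𝓝 t] ((W - besselJ 0) ^ 2 +
        ((V - fun t => t * besselD 0 t) / id) ^ 2 : ℝ → ℝ) := by
      filter_upwards [lt_mem_nhds ht.1] with s hs
      simp only [he, Pi.add_apply, Pi.pow_apply, Pi.sub_apply, Pi.div_apply, id]
      field_simp
    refine (h3.congr_of_eventuallyEq heq).congr_deriv ?_
    simp only [Pi.sub_apply, Pi.div_apply, id, hη, zero_pow two_ne_zero, zero_div, sub_zero,
      Nat.add_one_sub_one, pow_one, Nat.cast_ofNat]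
    field_simp
    ring
  have hanti : AntitoneOn (fun t => exp (-t) * (e t + (p - 1) ^ 2)) (Set.Ioo 0 c) := by
    have hd : ∀ t ∈ Set.Ioo 0 c, HasDerivAt (fun t => exp (-t) * (e t + (p - 1) ^ 2))
        (exp (-t) * ((2 * (V t / t - besselD 0 t) * (-η t) - 2 * (V t / t - besselD 0 t) ^ 2 / t)
          - (e t + (p - 1) ^ 2))) t := fun t ht =>
      (((hasDerivAt_neg t).exp).mul ((hDer t ht).add_const _)).congr_deriv (by ring)
    refine antitoneOn_of_deriv_nonpos (convex_Ioo 0 c)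
      (fun t ht => (hd t ht).continuousAt.continuousWithinAt)
      (fun t ht => (hd t (interior_subset ht)).differentiableAt.differentiableWithinAt)
      fun t ht => ?_
    have ht' : t ∈ Set.Ioo 0 c := interior_subset ht
    rw [(hd t ht').deriv]
    refine mul_nonpos_of_nonneg_of_nonpos (exp_pos _).le ?_
    have h1 : (η t) ^ 2 ≤ (p - 1) ^ 2 := by
      rw [← sq_abs]
      exact pow_le_pow_left₀ (abs_nonneg _) (abs_rpow_mul_self_sub_le hp (h.abs_le_one t ht')) 2
    have h2 : 0 ≤ 2 * (V t / t - besselD 0 t) ^ 2 / t := by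
      have := ht'.1
      positivity
    simp only [he]
    nlinarith [sq_nonneg (V t / t - besselD 0 t + η t), sq_nonneg (W t - besselJ 0 t)]
  have hlim : Tendsto (fun t => exp (-t) * (e t + (p - 1) ^ 2)) (𝓝[>] 0) (𝓝 ((p - 1) ^ 2)) := by
    have h1 : Tendsto (besselJ 0) (𝓝[>] 0) (𝓝 1) := by
      have := ((continuous_besselJ le_rfl).tendsto (0 : ℝ)).mono_left
        (nhdsWithin_le_nhds (s := Set.Ioi 0))
      rwa [besselJ_zero_zero] at this
    have h2 : Tendsto (besselD 0) (𝓝[>] 0) (𝓝 0) := by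
      have := (continuous_besselD_zero.tendsto (0 : ℝ)).mono_left
        (nhdsWithin_le_nhds (s := Set.Ioi 0))
      rwa [besselD_zero, zero_div, zero_mul, neg_zero] at this
    have h3 : Tendsto (fun t : ℝ => exp (-t)) (𝓝[>] 0) (𝓝 1) := by
      have : Continuous fun t : ℝ => exp (-t) := by fun_prop
      simpa using (this.tendsto 0).mono_left (nhdsWithin_le_nhds (s := Set.Ioi 0))
    simpa using h3.mul (((h.tendsto_fst.sub h1).pow 2).add ((h.tendsto_snd.sub h2).pow 2)
      |>.add_const ((p - 1) ^ 2))
  have hle : exp (-t) * (e t + (p - 1) ^ 2) ≤ (p - 1) ^ 2 := by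
    refine ge_of_tendsto hlim ?_
    filter_upwards [Ioo_mem_nhdsGT ht.1] with s hs
    exact hanti ⟨hs.1, hs.2.trans ht.2⟩ ht hs.2.le
  have h4 : e t ≤ (p - 1) ^ 2 * exp t := by
    rw [exp_neg, inv_mul_le_iff₀ (exp_pos t)] at hle
    nlinarith [sq_nonneg (p - 1)]
  refine h4.trans ?_
  rw [mul_pow]
  have := one_le_exp ht.1.le
  gcongr
  nlinarith

lemma IsRadialProfile.abs_fst_sub_le {p c : ℝ} {W V : ℝ → ℝ} (h : IsRadialProfile p c W V)
    (hp : 1 < p) {t : ℝ} (ht : t ∈ Set.Ioo 0 c) :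
    |W t - besselJ 0 t| ≤ (p - 1) * exp t :=
  abs_le_of_sq_le_sq (by nlinarith [h.sq_add_sq_le hp ht, sq_nonneg (V t / t - besselD 0 t)])
    (mul_nonneg (by linarith) (exp_pos t).le)

lemma IsRadialProfile.abs_snd_sub_le {p c : ℝ} {W V : ℝ → ℝ} (h : IsRadialProfile p c W V)
    (hp : 1 < p) {t : ℝ} (ht : t ∈ Set.Ioo 0 c) :
    |V t / t - besselD 0 t| ≤ (p - 1) * exp t :=
  abs_le_of_sq_le_sq (by nlinarith [h.sq_add_sq_le hp ht, sq_nonneg (W t - besselJ 0 t)])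
    (mul_nonneg (by linarith) (exp_pos t).le)

/-- For `p` close to `1`, a profile with an interior zero ends beyond any point
below the second zero of `J₀`. -/
lemma eventually_lt_of_isRadialProfile {z T : ℝ} (hz : IsNthZero 0 2 z) (hT : T < z) :
    ∀ᶠ p in 𝓝[>] (1 : ℝ), ∀ c W V, IsRadialProfile p c W V → (∃ t ∈ Set.Ioo 0 c, W t = 0) →
      T < c := by
  obtain ⟨z₁, hz₁, hJ, huniq⟩ := exists_unique_zero_besselJ_zero hz
  have hD := abs_pos.2 (besselD_zero_ne_zero hz₁.1 hJ)
  set m := |besselD 0 z₁| / 2 with hm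
  obtain ⟨δ, hδ, hδm⟩ : ∃ δ > 0, ∀ t ∈ ball z₁ δ, m < |besselD 0 t| := by
    have := (continuous_besselD_zero.abs.tendsto z₁).eventually
      (lt_mem_nhds (show m < |besselD 0 z₁| by linarith))
    exact Metric.eventually_nhds_iff_ball.1 this
  obtain ⟨μ, hμ, hμJ⟩ : ∃ μ, 0 < μ ∧ ∀ t ∈ Set.Icc 0 T \ ball z₁ δ, μ ≤ |besselJ 0 t| := by
    refine (isCompact_Icc.diff isOpen_ball).exists_forall_le'
      (continuous_besselJ le_rfl).abs.continuousOn fun t ht => abs_pos.2 fun h0 => ?_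
    rcases ht.1.1.eq_or_lt with rfl | hpos
    · simp [besselJ_zero_zero] at h0
    · exact ht.2 (by simpa [huniq t ⟨hpos, ht.1.2.trans_lt hT⟩ h0] using hδ)
  have hev : ∀ᶠ p in 𝓝[>] (1 : ℝ), (p - 1) * exp T < min m μ := by
    have hc : Continuous fun p : ℝ => (p - 1) * exp T := by fun_prop
    refine ((hc.tendsto 1).eventually (gt_mem_nhds ?_)).filter_mono nhdsWithin_le_nhds
    rw [sub_self, zero_mul]
    exact lt_min (by linarith) hμ
  filter_upwards [hev, self_mem_nhdsWithin] with p hpm (hp : 1 < p) c W V h ⟨t₁, ht₁, hWt₁⟩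
  by_contra! hcT
  have hle : ∀ t ∈ Set.Ioo 0 c, (p - 1) * exp t < min m μ := fun t ht =>
    lt_of_le_of_lt (mul_le_mul_of_nonneg_left (exp_le_exp.2 (ht.2.le.trans hcT)) (by linarith)) hpm
  have hmem : ∀ t, 0 < t → t ≤ c → |besselJ 0 t| < μ → t ∈ ball z₁ δ := fun t h0 htc hlt => by
    by_contra hnot
    exact absurd (hμJ t ⟨⟨h0.le, htc.trans hcT⟩, hnot⟩) (not_le.2 hlt)
  have h1 : t₁ ∈ ball z₁ δ := by
    refine hmem t₁ ht₁.1 ht₁.2.le ?_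
    have := h.abs_fst_sub_le hp ht₁
    rw [hWt₁, zero_sub, abs_neg] at this
    exact this.trans_lt ((hle t₁ ht₁).trans_le (min_le_right _ _))
  have h2 : c ∈ ball z₁ δ := by
    refine hmem c h.pos le_rfl (lt_of_le_of_lt ?_ (hpm.trans_le (min_le_right _ _)))
    have hlim : Tendsto (fun t => |W t - besselJ 0 t|) (𝓝[<] c) (𝓝 |besselJ 0 c|) := by
      have := (h.continuousWithinAt_end.tendsto.sub
        (((continuous_besselJ le_rfl).tendsto c).mono_left
          (nhdsWithin_le_nhds (s := Set.Iio c)))).abs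
      rwa [h.eq_zero_end, zero_sub, abs_neg] at this
    refine le_of_tendsto hlim ?_
    filter_upwards [Ioo_mem_nhdsLT h.pos] with t ht
    exact (h.abs_fst_sub_le hp ht).trans
      (mul_le_mul_of_nonneg_left (exp_le_exp.2 (ht.2.le.trans hcT)) (by linarith))
  have hcont : ContinuousOn W (Set.Icc t₁ c) := by
    intro t ht
    rcases ht.2.eq_or_lt with rfl | hlt
    · have := h.continuousWithinAt_end
      rw [← continuousWithinAt_insert_self, Set.Iio_insert] at this
      exact this.mono fun s hs => hs.2
    · exact (h.hasDerivAt_fst t ⟨ht₁.1.trans_le ht.1, hlt⟩).continuousAt.continuousWithinAt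
  obtain ⟨ξ, hξ, hξ0⟩ := exists_hasDerivAt_eq_zero ht₁.2 hcont (hWt₁.trans h.eq_zero_end.symm)
    fun t ht => h.hasDerivAt_fst t ⟨ht₁.1.trans ht.1, ht.2⟩
  have hξc : ξ ∈ Set.Ioo 0 c := ⟨ht₁.1.trans hξ.1, hξ.2⟩
  have h3 : ξ ∈ ball z₁ δ := by
    rw [Real.ball_eq_Ioo] at h1 h2 ⊢
    exact ⟨h1.1.trans hξ.1, hξ.2.trans h2.2⟩
  have h4 := h.abs_snd_sub_le hp hξc
  rw [hξ0, zero_sub, abs_neg] at h4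
  linarith [hδm ξ h3, hle ξ hξc, min_le_left m μ]

/-- Truncations of `J_β` are negative directions for Bessel operators of smaller order. -/
lemma exists_bessel_test_function {β ν z : ℝ} (hβ : 0 < β) (hν : 0 ≤ ν) (hνβ : ν < β)
    (hz : IsNthZero β 1 z) :
    ∃ ψ : ℝ → ℝ, ∃ a b : ℝ, ContDiff ℝ 1 ψ ∧ 0 < a ∧ a < b ∧ b < z ∧
      (∀ t, t ∉ Set.Icc a b → ψ t = 0) ∧
      ∫ t in a..b, (t * deriv ψ t ^ 2 + ν ^ 2 / t * ψ t ^ 2 - t * ψ t ^ 2) < 0 := by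
  have hJc := continuous_besselJ hβ.le
  obtain ⟨t₀, ht₀, hpos⟩ := exists_besselJ_pos hβ.le hz.1
  set κ := besselJ β t₀ / 6 with hκ
  obtain ⟨δ, hδ, hδκ⟩ : ∃ δ > 0, ∀ t ∈ ball t₀ δ, 3 * κ < besselJ β t ∧ t ∈ Set.Ioo 0 z := by
    have := ((hJc.tendsto t₀).eventually
      (lt_mem_nhds (show 3 * κ < besselJ β t₀ by linarith))).and (Ioo_mem_nhds ht₀.1 ht₀.2)
    exact Metric.eventually_nhds_iff_ball.1 this
  have hball : ∀ t ∈ Set.Icc t₀ (t₀ + δ / 2), t ∈ ball t₀ δ := fun t ht => by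
    rw [Real.ball_eq_Ioo]
    exact ⟨by linarith [ht.1], by linarith [ht.2]⟩
  have hb₀ : t₀ + δ / 2 < z := (hδκ _ (hball _ ⟨by linarith, le_rfl⟩)).2.2
  obtain ⟨M, hM⟩ : ∃ M, ∀ t ∈ Set.Icc 0 z, |besselJ β t| ≤ M :=
    (isCompact_Icc (a := (0 : ℝ)) (b := z)).exists_bound_of_continuousOn hJc.continuousOn
  have hgap : 0 < β ^ 2 - ν ^ 2 := by nlinarith
  have hdiv : ∀ (k : ℝ) (a b : ℝ), 0 < a → ContinuousOn (fun t : ℝ => k / t) (Set.Icc a b) :=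
    fun k a b ha => continuousOn_const.div continuousOn_id fun t ht => (ha.trans_le ht.1).ne'
  obtain ⟨ε, hε, hneg⟩ := exists_trunc_integral_neg (y := besselJ β) (D := besselD β)
    (A := fun t => t - β ^ 2 / t) (W := fun t => (β ^ 2 - ν ^ 2) / t) (R := z)
    (C := max z M) (κ := κ) (a₀ := t₀) (b₀ := t₀ + δ / 2) (by linarith) ht₀.1.le (by linarith)
    hb₀ (fun t ht => (hδκ t (hball t ht)).1.le)
    (fun t ht => le_trans (by linarith [ht.2, div_nonneg (sq_nonneg β) ht.1]) (le_max_left _ _))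
    (fun t ht => (hM t ⟨ht.1, ht.2.le⟩).trans (le_max_right _ _))
    (fun t ht => div_nonneg hgap.le ht.1)
    (fun t ht => div_pos hgap (ht₀.1.trans ht.1)) (hdiv _ _ _ ht₀.1)
  obtain ⟨a, ⟨ha0, hat⟩, haε⟩ : ∃ a ∈ Set.Ioo 0 t₀, ∀ t, 0 < t → t ≤ a → besselJ β t ≤ ε := by
    have h1 : ∀ᶠ t in 𝓝 (0 : ℝ), besselJ β t < ε :=
      (hJc.tendsto 0).eventually (gt_mem_nhds (by rwa [besselJ_apply_zero hβ]))
    obtain ⟨r, hr, hr'⟩ := Metric.eventually_nhds_iff_ball.1 h1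
    refine ⟨min (r / 2) (t₀ / 2), ⟨by have := ht₀.1; positivity, ?_⟩, fun t h0 ht => ?_⟩
    · linarith [min_le_right (r / 2) (t₀ / 2), ht₀.1]
    · refine (hr' t ?_).le
      rw [mem_ball_zero_iff, Real.norm_eq_abs, abs_of_pos h0]
      linarith [min_le_left (r / 2) (t₀ / 2)]
  obtain ⟨b, ⟨hbt, hbz⟩, hbε⟩ : ∃ b ∈ Set.Ioo (t₀ + δ / 2) z, ∀ t, b ≤ t → t < z →
      besselJ β t ≤ ε := by
    have h1 : ∀ᶠ t in 𝓝 z, besselJ β t < ε :=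
      (hJc.tendsto z).eventually (gt_mem_nhds (by rwa [hz.2.1]))
    obtain ⟨r, hr, hr'⟩ := Metric.eventually_nhds_iff_ball.1 h1
    refine ⟨max (z - r / 2) ((t₀ + δ / 2 + z) / 2), ⟨?_, ?_⟩, fun t ht htz => ?_⟩
    · exact lt_max_of_lt_right (by linarith)
    · exact max_lt (by linarith) (by linarith)
    · refine (hr' t ?_).le
      rw [Real.ball_eq_Ioo]
      exact ⟨by linarith [le_max_left (z - r / 2) ((t₀ + δ / 2 + z) / 2)], by linarith⟩
  set ψ : ℝ → ℝ := fun t => if t ∈ Set.Ioo 0 z then trunc ε (besselJ β t) else 0 with hψ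
  have hψ0 : ∀ t, t ∉ Set.Icc a b → ψ t = 0 := fun t ht => by
    simp only [hψ]
    split_ifs with h
    · refine trunc_of_le hε ?_
      rcases le_or_gt t a with h1 | h1
      · exact haε t h.1 h1
      · exact hbε t (not_lt.1 fun h2 => ht ⟨h1.le, h2.le⟩) h.2
    · rfl
  have hDc := continuousOn_besselD hβ.le
  have hψd : ∀ t, HasDerivAt ψ
      (if t ∈ Set.Ioo 0 z then ramp ε (besselJ β t) * besselD β t else 0) t := fun t => by
    split_ifs with h
    · have h1 := (hasDerivAt_trunc ε (besselJ β t)).comp t (hasDerivAt_besselJ hβ.le h.1)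
      refine h1.congr_of_eventuallyEq ?_
      filter_upwards [Ioo_mem_nhds h.1 h.2] with s hs
      simp [hψ, hs.1, hs.2]
    · refine (hasDerivAt_const t (0 : ℝ)).congr_of_eventuallyEq ?_
      have : t ∉ Set.Icc a b := fun h' => h ⟨ha0.trans_le h'.1, h'.2.trans_lt hbz⟩
      filter_upwards [isClosed_Icc.isOpen_compl.mem_nhds this] with s hs using hψ0 s hs
  have hderiv : deriv ψ = fun t => if t ∈ Set.Ioo 0 z then ramp ε (besselJ β t) * besselD β t
      else 0 := funext fun t => (hψd t).deriv
  have hψc : ContDiff ℝ 1 ψ := by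
    refine contDiff_one_iff_deriv.2 ⟨fun t => (hψd t).differentiableAt, ?_⟩
    refine continuous_iff_continuousAt.2 fun t => ?_
    by_cases h : t ∈ Set.Ioo 0 z
    · have h1 : ContinuousAt (fun t => ramp ε (besselJ β t) * besselD β t) t :=
        ((continuous_ramp ε).comp hJc).continuousAt.mul
          (hDc.continuousAt (Ioi_mem_nhds h.1))
      refine h1.congr ?_
      filter_upwards [Ioo_mem_nhds h.1 h.2] with s hs
      rw [hderiv]
      simp [hs.1, hs.2]
    · refine (continuousAt_const (y := (0 : ℝ))).congr ?_
      have : t ∉ Set.Icc a b := fun h' => h ⟨ha0.trans_le h'.1, h'.2.trans_lt hbz⟩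
      filter_upwards [isClosed_Icc.isOpen_compl.mem_nhds this] with s hs
      have : ψ =ᶠ[𝓝 s] fun _ => 0 := by
        filter_upwards [isClosed_Icc.isOpen_compl.mem_nhds hs] with r hr using hψ0 r hr
      rw [this.deriv_eq, deriv_const]
  refine ⟨ψ, a, b, hψc, ha0, by linarith, hbz, hψ0, ?_⟩
  have hsub : Set.Icc a b ⊆ Set.Ioi 0 := fun t ht => ha0.trans_le ht.1
  have hfin := hneg a b ha0.le hat.le hbt.le hbz hJc.continuousOn (hDc.mono hsub)
    (continuousOn_id.sub (hdiv _ _ _ ha0)) (hdiv _ _ _ ha0)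
    (fun t ht => hasDerivAt_besselJ hβ.le (ha0.trans ht.1))
    (fun t ht => hasDerivAt_mul_besselD hβ.le (ha0.trans ht.1))
    (Or.inr (haε a ha0 le_rfl)) (hbε b le_rfl hbz)
  refine lt_of_eq_of_lt ?_ hfin
  refine intervalIntegral.integral_congr fun t ht => ?_
  rw [Set.uIcc_of_le (by linarith)] at ht
  have ht' : t ∈ Set.Ioo 0 z := ⟨ha0.trans_le ht.1, ht.2.trans_lt hbz⟩
  have ht0 : t ≠ 0 := ht'.1.ne'
  rw [hderiv]
  simp only [hψ, if_pos ht']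
  field_simp
  ring

/-- The truncated Bessel function remains a negative direction for the linearization at a radial
profile, provided the exponent is close to `1`. -/
lemma eventually_test_function_neg {ψ : ℝ → ℝ} {a b ν z : ℝ} (hz : IsNthZero 0 2 z)
    (hψ : ContDiff ℝ 1 ψ) (ha : 0 < a) (hab : a < b) (hbz : b < z)
    (hneg : ∫ t in a..b, (t * deriv ψ t ^ 2 + ν ^ 2 / t * ψ t ^ 2 - t * ψ t ^ 2) < 0) :
    ∀ᶠ p in 𝓝[>] (1 : ℝ), ∀ c W V, IsRadialProfile p c W V → (∃ t ∈ Set.Ioo 0 c, W t = 0) →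
      b < c ∧ ∫ t in a..b, (t * deriv ψ t ^ 2 + ν ^ 2 / t * ψ t ^ 2
        - p * t * |W t| ^ (p - 1) * ψ t ^ 2) < 0 := by
  obtain ⟨z₁, -, -, huniq⟩ := exists_unique_zero_besselJ_zero hz
  have hJc := continuous_besselJ (β := 0) le_rfl
  have hψd : Continuous (deriv ψ) := hψ.continuous_deriv le_rfl
  have hψc := hψ.continuous
  set w : ℝ → ℝ → ℝ := fun p t => max (|besselJ 0 t| - (p - 1) * exp b) 0 ^ (p - 1) with hw
  set N : ℝ → ℝ := fun t => t * deriv ψ t ^ 2 + ν ^ 2 / t * ψ t ^ 2 with hN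
  have hNc : ContinuousOn N (Set.Icc a b) := by
    have h1 : ContinuousOn (fun t : ℝ => ν ^ 2 / t) (Set.Icc a b) :=
      continuousOn_const.div continuousOn_id fun t ht => (ha.trans_le ht.1).ne'
    exact (Continuous.continuousOn (by fun_prop)).add (h1.mul (hψc.pow 2).continuousOn)
  have hii : ∀ f : ℝ → ℝ, ContinuousOn f (Set.Icc a b) → IntervalIntegrable f volume a b :=
    fun f hf => ContinuousOn.intervalIntegrable (by rwa [Set.uIcc_of_le hab.le])
  have hwc : ∀ p : ℝ, 1 < p → Continuous (w p) := fun p hp =>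
    (Continuous.max (by fun_prop) continuous_const).rpow_const
      fun t => Or.inr (by linarith)
  obtain ⟨M, hM⟩ : ∃ M, ∀ t ∈ Set.Icc a b, |besselJ 0 t| ≤ M :=
    (isCompact_Icc (a := a) (b := b)).exists_bound_of_continuousOn hJc.continuousOn
  have hlim : Tendsto (fun p => ∫ t in a..b, (N t - t * w p t * ψ t ^ 2)) (𝓝[>] 1)
      (𝓝 (∫ t in a..b, (N t - t * 1 * ψ t ^ 2))) := by
    refine intervalIntegral.tendsto_integral_filter_of_dominated_convergence
      (fun t => |N t| + |t| * (max M 1) * ψ t ^ 2) ?_ ?_ ?_ ?_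
    · filter_upwards [self_mem_nhdsWithin] with p (hp : 1 < p)
      have := hwc p hp
      have h1 : IntervalIntegrable (fun t => N t - t * w p t * ψ t ^ 2) volume a b :=
        hii _ (hNc.sub (Continuous.continuousOn (by fun_prop)))
      rw [Set.uIoc_of_le hab.le]
      exact h1.1.aestronglyMeasurable
    · filter_upwards [self_mem_nhdsWithin, Ioo_mem_nhdsGT (show (1 : ℝ) < 2 by norm_num)]
        with p (hp : 1 < p) hp2
      refine .of_forall fun t ht => ?_
      rw [Set.uIoc_of_le hab.le] at ht
      have hw0 : 0 ≤ w p t := rpow_nonneg (le_max_right _ _) _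
      have hw1 : w p t ≤ max M 1 := by
        have h1 : max (|besselJ 0 t| - (p - 1) * exp b) 0 ≤ max M 1 := by
          have := hM t ⟨ht.1.le, ht.2⟩
          have h2 : 0 ≤ (p - 1) * exp b := mul_nonneg (by linarith) (exp_pos b).le
          exact max_le (le_max_of_le_left (by linarith)) (le_max_of_le_right zero_le_one)
        calc w p t ≤ max M 1 ^ (p - 1) := rpow_le_rpow (le_max_right _ _) h1 (by linarith)
          _ ≤ max M 1 ^ (1 : ℝ) := rpow_le_rpow_of_exponent_le (le_max_right _ _)
              (by linarith [hp2.2])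
          _ = max M 1 := rpow_one _
      rw [Real.norm_eq_abs]
      refine (abs_sub _ _).trans ?_
      rw [abs_mul, abs_mul, abs_of_nonneg hw0, abs_of_nonneg (sq_nonneg (ψ t))]
      gcongr
    · exact (hii _ (hNc.abs.add (Continuous.continuousOn (by fun_prop))))
    · have hne : ∀ᵐ t : ℝ, t ≠ z₁ := by simp [ae_iff]
      filter_upwards [hne] with t ht hts
      rw [Set.uIoc_of_le hab.le] at hts
      have hJ : 0 < |besselJ 0 t| :=
        abs_pos.2 fun h0 => ht (huniq t ⟨ha.trans hts.1, hts.2.trans_lt hbz⟩ h0)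
      have hc1 : Tendsto (fun p : ℝ => max (|besselJ 0 t| - (p - 1) * exp b) 0) (𝓝[>] 1)
          (𝓝 |besselJ 0 t|) := by
        have : Continuous fun p : ℝ => max (|besselJ 0 t| - (p - 1) * exp b) 0 := by fun_prop
        simpa [hJ.le] using (this.tendsto 1).mono_left (nhdsWithin_le_nhds (s := Set.Ioi 1))
      have hc2 : Tendsto (fun p : ℝ => p - 1) (𝓝[>] 1) (𝓝 0) := by
        have : Continuous fun p : ℝ => p - 1 := by fun_prop
        simpa using (this.tendsto 1).mono_left (nhdsWithin_le_nhds (s := Set.Ioi 1))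
      have hc3 : Tendsto (fun p => w p t) (𝓝[>] 1) (𝓝 1) := by
        simpa using hc1.rpow hc2 (Or.inl hJ.ne')
      exact ((hc3.const_mul t).mul_const _).const_sub _
  have hlt : ∫ t in a..b, (N t - t * 1 * ψ t ^ 2) < 0 := by simpa [hN] using hneg
  filter_upwards [hlim.eventually (gt_mem_nhds hlt), eventually_lt_of_isRadialProfile hz hbz,
    self_mem_nhdsWithin] with p hp₁ hp₂ (hp : 1 < p) c W V hWV h0
  have hbc := hp₂ c W V hWV h0
  refine ⟨hbc, lt_of_le_of_lt ?_ hp₁⟩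
  have hmem : ∀ t ∈ Set.Icc a b, t ∈ Set.Ioo 0 c := fun t ht =>
    ⟨ha.trans_le ht.1, ht.2.trans_lt hbc⟩
  have hWc : ContinuousOn (fun t => |W t| ^ (p - 1)) (Set.Icc a b) := fun t ht =>
    ((hWV.hasDerivAt_fst t (hmem t ht)).continuousAt.abs.rpow_const
      (Or.inr (by linarith))).continuousWithinAt
  have := hwc p hp
  refine intervalIntegral.integral_mono_on hab.le
    (hii _ (hNc.sub (((continuousOn_const.mul continuousOn_id).mul hWc).mul
      (hψc.pow 2).continuousOn)))
    (hii _ (hNc.sub (Continuous.continuousOn (by fun_prop)))) fun t ht => ?_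
  have ht0 : 0 < t := ha.trans_le ht.1
  have h1 : w p t ≤ |W t| ^ (p - 1) := by
    refine rpow_le_rpow (le_max_right _ _) (max_le ?_ (abs_nonneg _)) (by linarith)
    have h2 := hWV.abs_fst_sub_le hp (hmem t ht)
    have h3 : (p - 1) * exp t ≤ (p - 1) * exp b :=
      mul_le_mul_of_nonneg_left (exp_le_exp.2 ht.2) (by linarith)
    have h4 := abs_sub_abs_le_abs_sub (besselJ 0 t) (W t)
    rw [abs_sub_comm] at h4
    linarith
  have h5 : 0 ≤ |W t| ^ (p - 1) := rpow_nonneg (abs_nonneg _) _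
  have h6 : w p t ≤ p * |W t| ^ (p - 1) := h1.trans (le_mul_of_one_le_left h5 hp.le)
  have h7 := mul_le_mul_of_nonneg_right (mul_le_mul_of_nonneg_left h6 ht0.le) (sq_nonneg (ψ t))
  simp only [hN]
  linarith

/-- The radial Hénon equation `(r g')' = -r ^ (1 + α) |g| ^ (p - 1) g` on `(0, 1)` with
`D = g'` and `g(1) = 0`. -/
structure IsRadialHenonSol (α p : ℝ) (g D : ℝ → ℝ) : Prop where
  continuousOn : ContinuousOn g (Set.Icc 0 1)
  continuousOn_deriv : ContinuousOn D (Set.Ico 0 1)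
  hasDerivAt : ∀ r ∈ Set.Ioo (0 : ℝ) 1, HasDerivAt g (D r) r
  hasDerivAt_mul : ∀ r ∈ Set.Ioo (0 : ℝ) 1, HasDerivAt (fun r => r * D r)
    (-(r ^ (1 + α) * |g r| ^ (p - 1) * g r)) r
  eq_zero : g 1 = 0

lemma IsRadialHenonSol.neg {α p : ℝ} {g D : ℝ → ℝ} (h : IsRadialHenonSol α p g D) :
    IsRadialHenonSol α p (fun r => -g r) (fun r => -D r) where
  continuousOn := h.continuousOn.neg
  continuousOn_deriv := h.continuousOn_deriv.neg
  hasDerivAt r hr := (h.hasDerivAt r hr).fun_neg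
  hasDerivAt_mul r hr := by
    simp_rw [mul_neg, abs_neg]
    exact (h.hasDerivAt_mul r hr).fun_neg
  eq_zero := by simp [h.eq_zero]

lemma IsRadialHenonSol.exists_abs_mul_deriv_le {α p : ℝ} {g D : ℝ → ℝ} (hα : 0 ≤ α)
    (h : IsRadialHenonSol α p g D) (hp : 1 < p) :
    ∃ K, ∀ r ∈ Set.Ico (0 : ℝ) 1, |r * D r| ≤ K * r ^ (2 + α) := by
  obtain ⟨M, hM⟩ := (isCompact_Icc (a := (0 : ℝ)) (b := 1)).exists_bound_of_continuousOn
    h.continuousOn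
  have hM0 : 0 ≤ M := (norm_nonneg _).trans (hM 0 ⟨le_rfl, zero_le_one⟩)
  set K := M ^ (p - 1) * M with hK
  have hbound : ∀ r ∈ Set.Ioo (0 : ℝ) 1, |(r ^ (1 + α) * |g r| ^ (p - 1) * g r)|
      ≤ K * r ^ (1 + α) := fun r hr => by
    have h0 : 0 ≤ r ^ (1 + α) := rpow_nonneg hr.1.le _
    have h1 : |g r| ≤ M := hM r ⟨hr.1.le, hr.2.le⟩
    have h2 : 0 ≤ |g r| ^ (p - 1) := rpow_nonneg (abs_nonneg _) _
    rw [abs_mul, abs_mul, abs_of_nonneg h0, abs_of_nonneg h2, hK, mul_assoc, mul_comm]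
    gcongr
  have hpow : ∀ r ∈ Set.Ioo (0 : ℝ) 1, HasDerivAt (fun r => K * r ^ (2 + α) / (2 + α))
      (K * r ^ (1 + α)) r := fun r hr => by
    refine (((Real.hasDerivAt_rpow_const (p := 2 + α) (Or.inl hr.1.ne')).const_mul K).div_const
      (2 + α)).congr_deriv ?_
    rw [show 2 + α - 1 = 1 + α by ring]
    have : 2 + α ≠ 0 := by positivity
    field_simp
  have hmc : ContinuousOn (fun r => r * D r) (Set.Ico 0 1) :=
    continuousOn_id.mul h.continuousOn_deriv
  have hpc : Continuous fun r : ℝ => K * r ^ (2 + α) / (2 + α) :=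
    (continuous_const.mul (Real.continuous_rpow_const (by positivity))).div_const _
  have hmain : ∀ s : ℝ, s ^ 2 = 1 → ∀ r ∈ Set.Ico (0 : ℝ) 1,
      0 ≤ s * (r * D r) + K * r ^ (2 + α) / (2 + α) := by
    intro s hs r hr
    have hd : ∀ r ∈ Set.Ioo (0 : ℝ) 1, HasDerivAt
        (fun r => s * (r * D r) + K * r ^ (2 + α) / (2 + α))
        (s * -(r ^ (1 + α) * |g r| ^ (p - 1) * g r) + K * r ^ (1 + α)) r := fun r hr =>
      ((h.hasDerivAt_mul r hr).const_mul s).add (hpow r hr)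
    have hmono : MonotoneOn (fun r => s * (r * D r) + K * r ^ (2 + α) / (2 + α))
        (Set.Ico 0 1) := by
      refine monotoneOn_of_deriv_nonneg (convex_Ico 0 1)
        ((continuousOn_const.mul hmc).add hpc.continuousOn) ?_ ?_ <;> rw [interior_Ico]
      · exact fun r hr => (hd r hr).differentiableAt.differentiableWithinAt
      · intro r hr
        rw [(hd r hr).deriv]
        have h1 := hbound r hr
        have hs1 : |s| = 1 := by
          rcases sq_eq_sq_iff_eq_or_eq_neg.1 (hs.trans (one_pow 2).symm) with rfl | rfl <;> simp
        have h2 := neg_abs_le (s * -(r ^ (1 + α) * |g r| ^ (p - 1) * g r))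
        rw [abs_mul, hs1, one_mul, abs_neg] at h2
        linarith
    have := hmono ⟨le_rfl, zero_lt_one⟩ hr hr.1
    simpa [zero_rpow (show 2 + α ≠ 0 by positivity)] using this
  refine ⟨K / (2 + α), fun r hr => abs_le.2 ?_⟩
  have h1 := hmain 1 (by norm_num) r hr
  have h2 := hmain (-1) (by norm_num) r hr
  rw [div_mul_eq_mul_div]
  constructor <;> linarith

lemma IsRadialHenonSol.abs_le {α p : ℝ} {g D : ℝ → ℝ} (hα : 0 ≤ α)
    (h : IsRadialHenonSol α p g D) (hp : 1 < p) {r : ℝ} (hr : r ∈ Set.Ioo (0 : ℝ) 1) :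
    |g r| ≤ |g 0| := by
  obtain ⟨K, hK⟩ := h.exists_abs_mul_deriv_le hα hp
  set e : ℝ → ℝ := fun r => (r * D r) ^ 2 * r ^ (-(2 + α)) / 2 + |g r| ^ (p + 1) / (p + 1) with he
  have hd : ∀ r ∈ Set.Ioo (0 : ℝ) 1, HasDerivAt e
      (-((2 + α) / 2 * (r * D r) ^ 2 * r ^ (-(2 + α) - 1))) r := fun r hr => by
    have h1 := (((h.hasDerivAt_mul r hr).pow 2).mul
      (Real.hasDerivAt_rpow_const (p := -(2 + α)) (Or.inl hr.1.ne'))).div_const 2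
    have h2 := ((hasDerivAt_abs_rpow (g r) (p := p + 1) (by linarith)).comp r
      (h.hasDerivAt r hr)).div_const (p + 1)
    refine (h1.add h2).congr_deriv ?_
    have hp1 : p + 1 ≠ 0 := by linarith
    have h3 : r ^ (1 + α) * r ^ (-(2 + α)) * r = 1 := by
      rw [← rpow_add hr.1, ← rpow_add_one hr.1.ne']
      ring_nf
      exact rpow_zero r
    rw [show p + 1 - 2 = p - 1 by ring]
    simp only [Pi.pow_apply]
    field_simp
    push_cast
    linear_combination (-2 * D r * |g r| ^ (p - 1) * g r) * h3
  have hanti : AntitoneOn e (Set.Ioo 0 1) := by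
    refine antitoneOn_of_deriv_nonpos (convex_Ioo 0 1)
      (fun t ht => (hd t ht).continuousAt.continuousWithinAt)
      (fun t ht => (hd t (interior_subset ht)).differentiableAt.differentiableWithinAt)
      fun t ht => ?_
    have ht' : t ∈ Set.Ioo (0 : ℝ) 1 := interior_subset ht
    rw [(hd t ht').deriv]
    have := ht'.1
    have : 0 ≤ (2 + α) / 2 * (t * D t) ^ 2 * t ^ (-(2 + α) - 1) := by positivity
    linarith
  have hg0 : Tendsto g (𝓝[>] 0) (𝓝 (g 0)) :=
    (h.continuousOn 0 ⟨le_rfl, zero_le_one⟩).tendsto.mono_left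
      (nhdsWithin_le_of_mem (mem_of_superset (Ioo_mem_nhdsGT zero_lt_one)
        fun x hx => ⟨hx.1.le, hx.2.le⟩))
  have hlim : Tendsto e (𝓝[>] 0) (𝓝 (0 / 2 + |g 0| ^ (p + 1) / (p + 1))) := by
    refine (Tendsto.div_const ?_ 2).add ((hg0.abs.rpow_const (Or.inr (by linarith))).div_const _)
    have hc : Tendsto (fun r : ℝ => K ^ 2 * r ^ (2 + α)) (𝓝[>] 0) (𝓝 0) := by
      have : Continuous fun r : ℝ => K ^ 2 * r ^ (2 + α) :=
        continuous_const.mul (Real.continuous_rpow_const (by positivity))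
      simpa [zero_rpow (show 2 + α ≠ 0 by positivity)] using
        (this.tendsto 0).mono_left (nhdsWithin_le_nhds (s := Set.Ioi 0))
    refine squeeze_zero' ?_ ?_ hc
    · filter_upwards [self_mem_nhdsWithin] with r (hr : 0 < r)
      positivity
    · filter_upwards [Ioo_mem_nhdsGT zero_lt_one] with r hr
      have h1 : (r * D r) ^ 2 ≤ (K * r ^ (2 + α)) ^ 2 := by
        rw [← sq_abs (r * D r)]
        exact pow_le_pow_left₀ (abs_nonneg _) (hK r ⟨hr.1.le, hr.2⟩) 2
      have h2 : 0 < r ^ (2 + α) := rpow_pos_of_pos hr.1 _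
      rw [rpow_neg hr.1.le, ← div_eq_mul_inv, div_le_iff₀ h2]
      linarith
  have h1 : e r ≤ 0 / 2 + |g 0| ^ (p + 1) / (p + 1) := by
    refine ge_of_tendsto hlim ?_
    filter_upwards [Ioo_mem_nhdsGT hr.1] with s hs
    exact hanti ⟨hs.1, hs.2.trans hr.2⟩ hr hs.2.le
  have h2 : |g r| ^ (p + 1) ≤ |g 0| ^ (p + 1) := by
    have h3 : 0 ≤ (r * D r) ^ 2 * r ^ (-(2 + α)) / 2 := by
      have := hr.1
      positivity
    have h4 : |g r| ^ (p + 1) / (p + 1) ≤ |g 0| ^ (p + 1) / (p + 1) := by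
      simp only [he] at h1
      linarith
    exact (div_le_div_iff_of_pos_right (by linarith)).1 h4
  exact (rpow_le_rpow_iff (abs_nonneg _) (abs_nonneg _) (by linarith)).1 h2

/-- The radius corresponding to the rescaled variable `t = c r ^ (1 + α / 2)`. -/
def scaledRadius (α c t : ℝ) : ℝ := (t / c) ^ (1 + α / 2)⁻¹

lemma hasDerivAt_scaledRadius {α c t : ℝ} (hα : 0 ≤ α) (hc : 0 < c) (ht : 0 < t) :
    HasDerivAt (scaledRadius α c) (scaledRadius α c t / ((1 + α / 2) * t)) t := by
  have h1 := ((hasDerivAt_id t).div_const c).rpow_const (p := (1 + α / 2)⁻¹)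
    (Or.inl (div_pos ht hc).ne')
  refine h1.congr_deriv ?_
  have : 1 + α / 2 ≠ 0 := by positivity
  simp only [id]
  rw [rpow_sub_one (div_pos ht hc).ne', scaledRadius]
  field_simp

lemma scaledRadius_mem {α c t : ℝ} (hα : 0 ≤ α) (hc : 0 < c) (ht : t ∈ Set.Ioo 0 c) :
    scaledRadius α c t ∈ Set.Ioo 0 1 :=
  ⟨rpow_pos_of_pos (div_pos ht.1 hc) _,
    rpow_lt_one (div_pos ht.1 hc).le ((div_lt_one hc).2 ht.2) (by positivity)⟩

lemma scaledRadius_mul_rpow {α c r : ℝ} (hα : 0 ≤ α) (hc : 0 < c) (hr : 0 ≤ r) :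
    scaledRadius α c (c * r ^ (1 + α / 2)) = r := by
  rw [scaledRadius, mul_div_cancel_left₀ _ hc.ne', rpow_rpow_inv hr (by positivity)]

lemma scaledRadius_rpow {α c t : ℝ} (hα : 0 ≤ α) (hc : 0 < c) (ht : 0 ≤ t) :
    scaledRadius α c t ^ (2 + α) = (t / c) ^ 2 := by
  have h0 : 1 + α / 2 ≠ 0 := by positivity
  have h1 : (1 + α / 2)⁻¹ * (2 + α) = (2 : ℕ) := by
    field_simp
    push_cast
    ring
  rw [scaledRadius, ← rpow_mul (div_nonneg ht hc.le), h1, rpow_natCast]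

lemma IsRadialHenonSol.isRadialProfile {α p c : ℝ} {g D : ℝ → ℝ} (hα : 0 ≤ α)
    (h : IsRadialHenonSol α p g D) (hp : 1 < p) (h0 : g 0 ≠ 0) (hc : 0 < c)
    (hc2 : (c * (1 + α / 2)) ^ 2 = |g 0| ^ (p - 1)) :
    IsRadialProfile p c (fun t => g (scaledRadius α c t) / g 0)
      (fun t => scaledRadius α c t * D (scaledRadius α c t) / ((1 + α / 2) * g 0)) := by
  have hγ : 1 + α / 2 ≠ 0 := by positivity
  have hρc : Continuous (scaledRadius α c) :=
    (Real.continuous_rpow_const (by positivity)).comp (continuous_id.div_const c)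
  have hρ0 : scaledRadius α c 0 = 0 := by
    rw [scaledRadius, zero_div, zero_rpow (by positivity)]
  have hρ1 : scaledRadius α c c = 1 := by rw [scaledRadius, div_self hc.ne', one_rpow]
  refine ⟨hc, fun t ht => ?_, fun t ht => ?_, fun t ht => ?_, ?_, ?_, ?_, ?_⟩
  · have ht0 := ht.1.ne'
    refine (((h.hasDerivAt _ (scaledRadius_mem hα hc ht)).comp t
      (hasDerivAt_scaledRadius hα hc ht.1)).div_const (g 0)).congr_deriv ?_
    field_simp
  · have ht0 := ht.1.ne'
    have hmem := scaledRadius_mem hα hc ht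
    refine (((h.hasDerivAt_mul _ hmem).comp t
      (hasDerivAt_scaledRadius hα hc ht.1)).div_const ((1 + α / 2) * g 0)).congr_deriv ?_
    have h1 := scaledRadius_rpow hα hc ht.1.le
    rw [show 2 + α = 1 + α + 1 by ring, rpow_add_one hmem.1.ne'] at h1
    have h2 : |g (scaledRadius α c t)| ^ (p - 1)
        = (c * (1 + α / 2)) ^ 2 * |g (scaledRadius α c t) / g 0| ^ (p - 1) := by
      rw [hc2, abs_div, div_rpow (abs_nonneg _) (abs_nonneg _), mul_div_cancel₀]
      exact (rpow_pos_of_pos (abs_pos.2 h0) _).ne'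
    rw [h2]
    have h3 : scaledRadius α c t ^ (1 + α) * scaledRadius α c t * c ^ 2 = t ^ 2 := by
      rw [h1]
      field_simp
    field_simp
    linear_combination (-g (scaledRadius α c t) * |g (scaledRadius α c t) / g 0| ^ (p - 1)) * h3
  · rw [abs_div]
    exact div_le_one_of_le₀ (h.abs_le hα hp (scaledRadius_mem hα hc ht)) (abs_nonneg _)
  · have h1 : Tendsto (scaledRadius α c) (𝓝[>] 0) (𝓝[Set.Icc 0 1] 0) := by
      refine tendsto_nhdsWithin_iff.2 ⟨?_, ?_⟩
      · simpa [hρ0] using (hρc.tendsto 0).mono_left (nhdsWithin_le_nhds (s := Set.Ioi 0))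
      · filter_upwards [Ioo_mem_nhdsGT hc] with t ht
        exact Set.Ioo_subset_Icc_self (scaledRadius_mem hα hc ht)
    simpa [h0] using ((h.continuousOn 0 ⟨le_rfl, zero_le_one⟩).tendsto.comp h1).div_const (g 0)
  · obtain ⟨K, hK⟩ := h.exists_abs_mul_deriv_le hα hp
    have hlim : Tendsto (fun t : ℝ => K / (|(1 + α / 2) * g 0| * c ^ 2) * t) (𝓝[>] 0) (𝓝 0) := by
      have : Continuous fun t : ℝ => K / (|(1 + α / 2) * g 0| * c ^ 2) * t := by fun_prop
      simpa using (this.tendsto 0).mono_left (nhdsWithin_le_nhds (s := Set.Ioi 0))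
    refine squeeze_zero_norm' ?_ hlim
    filter_upwards [Ioo_mem_nhdsGT hc] with t ht
    have hmem := scaledRadius_mem hα hc ht
    have h1 := hK _ ⟨hmem.1.le, hmem.2⟩
    rw [scaledRadius_rpow hα hc ht.1.le] at h1
    have hpos : 0 < |(1 + α / 2) * g 0| := abs_pos.2 (mul_ne_zero hγ h0)
    rw [Real.norm_eq_abs, abs_div, abs_div, abs_of_pos ht.1, div_le_iff₀ ht.1, div_le_iff₀ hpos]
    refine h1.trans_eq ?_
    field_simp
  · have h1 : Tendsto (scaledRadius α c) (𝓝[<] c) (𝓝[Set.Icc 0 1] 1) := by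
      refine tendsto_nhdsWithin_iff.2 ⟨?_, ?_⟩
      · simpa [hρ1] using (hρc.tendsto c).mono_left (nhdsWithin_le_nhds (s := Set.Iio c))
      · filter_upwards [Ioo_mem_nhdsLT hc] with t ht
        exact Set.Ioo_subset_Icc_self (scaledRadius_mem hα hc ht)
    have h2 := ((h.continuousOn 1 ⟨zero_le_one, le_rfl⟩).tendsto.comp h1).div_const (g 0)
    rw [← hρ1] at h2
    exact h2
  · simp [hρ1, h.eq_zero]

lemma norm_smul_single_zero_add (r s : ℝ) :
    ‖r • (EuclideanSpace.single 0 1 : E2) + s • EuclideanSpace.single 1 1‖ = √(r ^ 2 + s ^ 2) := by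
  simp [EuclideanSpace.norm_eq, Fin.sum_univ_two]

lemma norm_smul_single_zero {r : ℝ} (hr : 0 ≤ r) :
    ‖r • (EuclideanSpace.single 0 1 : E2)‖ = r := by
  simp [norm_smul, abs_of_nonneg hr]

lemma differentiableAt_fderiv_apply {u : E2 → ℝ} (hu : ContDiffOn ℝ 2 u (ball 0 1)) (e : E2)
    {x : E2} (hx : x ∈ ball (0 : E2) 1) : DifferentiableAt ℝ (fun y => fderiv ℝ u y e) x := by
  have h : ContDiffOn ℝ 1 (fderiv ℝ u) (ball 0 1) :=
    hu.fderiv_of_isOpen isOpen_ball (by norm_num)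
  exact ((h.differentiableOn one_ne_zero x hx).differentiableAt
    (isOpen_ball.mem_nhds hx)).clm_apply (differentiableAt_const e)

lemma lap_of_radial {u : E2 → ℝ} (hu : ContDiffOn ℝ 2 u (ball 0 1))
    (hrad : ∀ x ∈ ball (0 : E2) 1, u x = u (‖x‖ • EuclideanSpace.single 0 1)) {r : ℝ}
    (hr : r ∈ Set.Ioo (0 : ℝ) 1) :
    HasDerivAt (fun r : ℝ => r * fderiv ℝ u (r • EuclideanSpace.single 0 1)
      (EuclideanSpace.single 0 1)) (r * lap u (r • EuclideanSpace.single 0 1)) r := by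
  set e₀ : E2 := EuclideanSpace.single 0 1 with he₀
  set e₁ : E2 := EuclideanSpace.single 1 1 with he₁
  set D : ℝ → ℝ := fun r => fderiv ℝ u (r • e₀) e₀ with hD
  have hmem : ∀ ρ ∈ Set.Ioo (0 : ℝ) 1, ρ • e₀ ∈ ball (0 : E2) 1 := fun ρ hρ => by
    simpa [mem_ball_zero_iff, he₀, norm_smul_single_zero hρ.1.le] using
      (norm_smul_single_zero hρ.1.le).trans_lt hρ.2
  have hdu : ∀ x ∈ ball (0 : E2) 1, HasFDerivAt u (fderiv ℝ u x) x := fun x hx =>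
    ((hu.differentiableOn two_ne_zero x hx).differentiableAt
      (isOpen_ball.mem_nhds hx)).hasFDerivAt
  have hline : ∀ (e x : E2) (s : ℝ), HasDerivAt (fun s : ℝ => x + s • e) e s := fun e x s => by
    simpa using ((hasDerivAt_id s).smul_const e).const_add x
  have hlin0 : ∀ s : ℝ, HasDerivAt (fun s : ℝ => s • e₀) e₀ s := fun s => by
    simpa using (hasDerivAt_id s).smul_const e₀
  have hg : ∀ ρ ∈ Set.Ioo (0 : ℝ) 1, HasDerivAt (fun r : ℝ => u (r • e₀)) (D ρ) ρ :=
    fun ρ hρ => (hdu _ (hmem ρ hρ)).comp_hasDerivAt ρ (hlin0 ρ)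
  have hD' : HasDerivAt D (fderiv ℝ (fun y => fderiv ℝ u y e₀) (r • e₀) e₀) r := by
    have h := (differentiableAt_fderiv_apply hu e₀ (hmem r hr)).hasFDerivAt
    exact h.comp_hasDerivAt r (hlin0 r)
  have hpos : ∀ s : ℝ, 0 < r ^ 2 + s ^ 2 := fun s => by have := hr.1; positivity
  have hρ : ∀ s : ℝ, HasDerivAt (fun s : ℝ => √(r ^ 2 + s ^ 2)) (s / √(r ^ 2 + s ^ 2)) s :=
    fun s => by
    refine ((((hasDerivAt_id s).pow 2).const_add (r ^ 2)).sqrt (hpos s).ne').congr_deriv ?_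
    simp
    ring
  have hρ0 : √(r ^ 2 + 0 ^ 2) = r := by simp [sqrt_sq hr.1.le]
  have hev : ∀ᶠ s in 𝓝 (0 : ℝ), fderiv ℝ u (r • e₀ + s • e₁) e₁
      = D √(r ^ 2 + s ^ 2) / √(r ^ 2 + s ^ 2) * s := by
    have hc : ContinuousAt (fun s : ℝ => √(r ^ 2 + s ^ 2)) 0 := (hρ 0).continuousAt
    have h1 : ∀ᶠ s in 𝓝 (0 : ℝ), √(r ^ 2 + s ^ 2) < 1 :=
      hc.eventually_lt continuousAt_const (by rw [hρ0]; exact hr.2)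
    filter_upwards [h1.eventually_nhds] with s hs
    have hs1 : √(r ^ 2 + s ^ 2) ∈ Set.Ioo 0 1 := ⟨sqrt_pos.2 (hpos s), hs.self_of_nhds⟩
    have h2 : HasDerivAt (fun s : ℝ => u (r • e₀ + s • e₁))
        (fderiv ℝ u (r • e₀ + s • e₁) e₁) s := by
      refine (hdu _ ?_).comp_hasDerivAt s (hline e₁ (r • e₀) s)
      rw [mem_ball_zero_iff, norm_smul_single_zero_add]
      exact hs1.2
    have h3 : HasDerivAt (fun s : ℝ => u (√(r ^ 2 + s ^ 2) • e₀))
        (D √(r ^ 2 + s ^ 2) * (s / √(r ^ 2 + s ^ 2))) s := by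
      have h := hg _ hs1
      exact h.comp s (hρ s)
    have h4 : (fun s : ℝ => u (r • e₀ + s • e₁)) =ᶠ[𝓝 s]
        fun s : ℝ => u (√(r ^ 2 + s ^ 2) • e₀) := by
      filter_upwards [hs] with σ hσ
      rw [hrad _ (by rw [mem_ball_zero_iff, norm_smul_single_zero_add]; exact hσ),
        norm_smul_single_zero_add]
    rw [(h3.congr_of_eventuallyEq h4).unique h2 |>.symm]
    ring
  have h1 : fderiv ℝ (fun y => fderiv ℝ u y e₁) (r • e₀) e₁ = D r / r := by
    have hx : (fun s : ℝ => r • e₀ + s • e₁) 0 = r • e₀ := by simp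
    have h2 : HasDerivAt (fun s : ℝ => fderiv ℝ u (r • e₀ + s • e₁) e₁)
        (fderiv ℝ (fun y => fderiv ℝ u y e₁) (r • e₀) e₁) 0 := by
      have h := (differentiableAt_fderiv_apply hu e₁ (hmem r hr)).hasFDerivAt
      rw [← hx] at h
      have := h.comp_hasDerivAt 0 (hline e₁ (r • e₀) 0)
      rw [hx] at this
      exact this
    have hk : DifferentiableAt ℝ (fun s : ℝ => D √(r ^ 2 + s ^ 2) / √(r ^ 2 + s ^ 2)) 0 := by
      have hDr : DifferentiableAt ℝ D √(r ^ 2 + 0 ^ 2) := by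
        rw [hρ0]
        exact hD'.differentiableAt
      exact (hDr.comp (0 : ℝ) (hρ 0).differentiableAt).fun_div (hρ 0).differentiableAt
        (by rw [hρ0]; exact hr.1.ne')
    have h3 := (hk.hasDerivAt.mul (hasDerivAt_id (0 : ℝ))).congr_of_eventuallyEq hev
    rw [h2.unique h3]
    simp [sqrt_sq hr.1.le]
  refine ((hasDerivAt_id r).mul hD').congr_deriv ?_
  rw [lap, Fin.sum_univ_two, ← he₀, ← he₁, h1]
  have := hr.1.ne'
  simp only [id]
  field_simp
  ring

lemma IsHenonSol.isRadialHenonSol {α p : ℝ} {u : E2 → ℝ} (hu : IsHenonSol α p u)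
    (hrad : ∀ x ∈ closedBall (0 : E2) 1, u x = u (‖x‖ • EuclideanSpace.single 0 1)) :
    IsRadialHenonSol α p (fun r => u (r • EuclideanSpace.single 0 1))
      (fun r => fderiv ℝ u (r • EuclideanSpace.single 0 1) (EuclideanSpace.single 0 1)) := by
  obtain ⟨h2, hc, heq, hbd⟩ := hu
  have hlin : Continuous fun r : ℝ => r • (EuclideanSpace.single 0 1 : E2) := by fun_prop
  have hmem : ∀ ρ ∈ Set.Ico (0 : ℝ) 1, ρ • (EuclideanSpace.single 0 1 : E2) ∈ ball (0 : E2) 1 :=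
    fun ρ hρ => by
    rw [mem_ball_zero_iff, norm_smul_single_zero hρ.1]
    exact hρ.2
  refine ⟨hc.comp hlin.continuousOn fun r hr => ?_, ?_, fun r hr => ?_, fun r hr => ?_, ?_⟩
  · rw [mem_closedBall_zero_iff, norm_smul_single_zero hr.1]
    exact hr.2
  · have h : ContinuousOn (fderiv ℝ u) (ball 0 1) :=
      h2.continuousOn_fderiv_of_isOpen isOpen_ball (by norm_num)
    exact (h.comp hlin.continuousOn hmem).clm_apply continuousOn_const
  · have hx := hmem r ⟨hr.1.le, hr.2⟩
    have hd := ((h2.differentiableOn two_ne_zero _ hx).differentiableAt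
      (isOpen_ball.mem_nhds hx)).hasFDerivAt
    refine hd.comp_hasDerivAt r ?_
    simpa using (hasDerivAt_id r).smul_const (EuclideanSpace.single 0 1 : E2)
  · have hx := hmem r ⟨hr.1.le, hr.2⟩
    refine (lap_of_radial h2 (fun x hx => hrad x (ball_subset_closedBall hx)) hr).congr_deriv ?_
    have := heq _ hx
    rw [norm_smul_single_zero hr.1.le] at this
    rw [add_comm, rpow_add_one hr.1.ne']
    linear_combination (-r) * this
  · exact hbd _ (by rw [norm_smul_single_zero zero_le_one])

lemma polar_eq_smul (r θ : ℝ) :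
    polar r θ = r • (cos θ • (EuclideanSpace.single 0 1 : E2)
      + sin θ • EuclideanSpace.single 1 1) := by
  ext i
  fin_cases i <;> simp [polar]

lemma norm_polar {r : ℝ} (hr : 0 ≤ r) (θ : ℝ) : ‖polar r θ‖ = r := by
  rw [polar_eq_smul, norm_smul, norm_smul_single_zero_add]
  simp [abs_of_nonneg hr]

lemma continuous_polar : Continuous fun q : ℝ × ℝ => polar q.1 q.2 := by
  simp_rw [polar_eq_smul]
  fun_prop

lemma integrableOn_polar {F : E2 → ℝ} (hF : ContinuousOn F (closedBall 0 1)) :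
    IntegrableOn (fun q : ℝ × ℝ => q.1 * F (polar q.1 q.2))
      (Set.Ioc 0 1 ×ˢ Set.Ioc (-π) π) (volume.prod volume) := by
  have hc : ContinuousOn (fun q : ℝ × ℝ => q.1 * F (polar q.1 q.2))
      (Set.Icc 0 1 ×ˢ Set.Icc (-π) π) := by
    refine continuousOn_fst.mul (hF.comp continuous_polar.continuousOn fun q hq => ?_)
    rw [mem_closedBall_zero_iff, norm_polar hq.1.1]
    exact hq.1.2
  exact (hc.integrableOn_compact (isCompact_Icc.prod isCompact_Icc)).mono_set
    (Set.prod_mono Set.Ioc_subset_Icc_self Set.Ioc_subset_Icc_self)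

lemma intervalIntegrable_polar {F : E2 → ℝ} (hF : ContinuousOn F (closedBall 0 1)) :
    IntervalIntegrable (fun r => ∫ θ in -π..π, r * F (polar r θ)) volume 0 1 := by
  have h := integrableOn_polar hF
  rw [IntegrableOn, ← Measure.prod_restrict] at h
  rw [intervalIntegrable_iff_integrableOn_Ioc_of_le zero_le_one]
  simp_rw [intervalIntegral.integral_of_le (neg_le_self pi_pos.le)]
  exact h.integral_prod_left

lemma integral_ball_eq_polar {F : E2 → ℝ} (hF : ContinuousOn F (closedBall 0 1)) :
    ∫ x in ball (0 : E2) 1, F x = ∫ r in (0 : ℝ)..1, ∫ θ in -π..π, r * F (polar r θ) := by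
  have hmp : MeasurePreserving
      ((MeasurableEquiv.toLp 2 (Fin 2 → ℝ)).symm.trans MeasurableEquiv.finTwoArrow).symm :=
    ((volume_preserving_finTwoArrow ℝ).comp
      (EuclideanSpace.volume_preserving_symm_measurableEquiv_toLp (Fin 2))).symm
  have hpol : ∀ q : ℝ × ℝ,
      ((MeasurableEquiv.toLp 2 (Fin 2 → ℝ)).symm.trans MeasurableEquiv.finTwoArrow).symm
        (polarCoord.symm q) = polar q.1 q.2 := fun q => by
    ext i
    fin_cases i <;> rfl
  rw [← integral_indicator measurableSet_ball, ← hmp.integral_comp',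
    ← integral_comp_polarCoord_symm]
  simp_rw [hpol, smul_eq_mul]
  have h1 : ∫ q in polarCoord.target, q.1 * (ball (0 : E2) 1).indicator F (polar q.1 q.2)
      = ∫ q in Set.Ioo 0 1 ×ˢ Set.Ioo (-π) π, q.1 * F (polar q.1 q.2) := by
    rw [← integral_indicator (polarCoord.open_target.measurableSet),
      ← integral_indicator (measurableSet_Ioo.prod measurableSet_Ioo)]
    congr 1
    ext q
    by_cases hq : q ∈ polarCoord.target
    · rw [Set.indicator_of_mem hq]
      have hq0 : 0 < q.1 := hq.1
      by_cases h1 : q.1 < 1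
      · rw [Set.indicator_of_mem (show q ∈ Set.Ioo 0 1 ×ˢ Set.Ioo (-π) π from ⟨⟨hq0, h1⟩, hq.2⟩),
          Set.indicator_of_mem]
        rwa [mem_ball_zero_iff, norm_polar hq0.le]
      · rw [Set.indicator_of_notMem (by rwa [mem_ball_zero_iff, norm_polar hq0.le]),
          Set.indicator_of_notMem (fun h => h1 h.1.2), mul_zero]
    · rw [Set.indicator_of_notMem hq, Set.indicator_of_notMem]
      exact fun h => hq ⟨h.1.1, h.2⟩
  rw [h1, Measure.volume_eq_prod, setIntegral_prod]
  · rw [intervalIntegral.integral_of_le zero_le_one, integral_Ioc_eq_integral_Ioo]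
    simp_rw [intervalIntegral.integral_of_le (neg_le_self pi_pos.le), integral_Ioc_eq_integral_Ioo]
  · exact (integrableOn_polar hF).mono_set
      (Set.prod_mono Set.Ioo_subset_Ioc_self Set.Ioo_subset_Ioc_self)

lemma integral_add_mul_cos_sq {n : ℕ} (hn : 1 ≤ n) (a b : ℝ) :
    ∫ θ in -π..π, (a + b * cos (n * θ)) ^ 2 = 2 * π * a ^ 2 + π * b ^ 2 := by
  have hn' : (n : ℝ) ≠ 0 := by positivity
  have h1 : ∫ θ in -π..π, cos (n * θ) = 0 := by
    rw [intervalIntegral.integral_comp_mul_left (fun x => cos x) hn', integral_cos]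
    simp
  have h2 : ∫ θ in -π..π, cos (n * θ) ^ 2 = π := by
    rw [intervalIntegral.integral_comp_mul_left (fun x => cos x ^ 2) hn', integral_cos_sq]
    simp
    field_simp
  have h3 : ∀ θ : ℝ, (a + b * cos (n * θ)) ^ 2
      = a ^ 2 + 2 * a * b * cos (n * θ) + b ^ 2 * cos (n * θ) ^ 2 := fun θ => by ring
  simp_rw [h3]
  rw [intervalIntegral.integral_add, intervalIntegral.integral_add,
    intervalIntegral.integral_const_mul, intervalIntegral.integral_const_mul, h1, h2]
  · simp
    ring
  all_goals exact Continuous.intervalIntegrable (by fun_prop) _ _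

lemma integral_mul_sin_sq {n : ℕ} (hn : 1 ≤ n) (b : ℝ) :
    ∫ θ in -π..π, (b * sin (n * θ)) ^ 2 = π * b ^ 2 := by
  have hn' : (n : ℝ) ≠ 0 := by positivity
  have h2 : ∫ θ in -π..π, sin (n * θ) ^ 2 = π := by
    rw [intervalIntegral.integral_comp_mul_left (fun x => sin x ^ 2) hn', integral_sin_sq]
    simp
    field_simp
  simp_rw [mul_pow]
  rw [intervalIntegral.integral_const_mul, h2, mul_comm]

lemma norm_sq_eq_polar (L : E2 →L[ℝ] ℝ) (θ : ℝ) :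
    ‖L‖ ^ 2 = (L (cos θ • EuclideanSpace.single 0 1 + sin θ • EuclideanSpace.single 1 1)) ^ 2
      + (L ((-sin θ) • EuclideanSpace.single 0 1 + cos θ • EuclideanSpace.single 1 1)) ^ 2 := by
  rw [(EuclideanSpace.basisFun (Fin 2) ℝ).norm_dual L, Fin.sum_univ_two]
  simp only [EuclideanSpace.basisFun_apply, map_add, map_smul, smul_eq_mul]
  linear_combination (-(L (EuclideanSpace.single 0 1)) ^ 2 - (L (EuclideanSpace.single 1 1)) ^ 2) *
    sin_sq_add_cos_sq θ

/-- A function `A(r) + C(r) cos (n θ)` in polar coordinates `(r, θ)` of the unit disc, where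
`A'` and `C'` are the derivatives of the coefficients. -/
structure IsCosMode (n : ℕ) (ψ : E2 → ℝ) (A A' C C' : ℝ → ℝ) : Prop where
  contDiff : ContDiff ℝ 1 ψ
  apply_polar : ∀ r ∈ Set.Ioo (0 : ℝ) 1, ∀ θ, ψ (polar r θ) = A r + C r * cos (n * θ)
  hasDerivAt_fst : ∀ r ∈ Set.Ioo (0 : ℝ) 1, HasDerivAt A (A' r) r
  hasDerivAt_snd : ∀ r ∈ Set.Ioo (0 : ℝ) 1, HasDerivAt C (C' r) r

lemma IsCosMode.norm_fderiv_sq {n : ℕ} {ψ : E2 → ℝ} {A A' C C' : ℝ → ℝ}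
    (h : IsCosMode n ψ A A' C C') {r : ℝ} (hr : r ∈ Set.Ioo (0 : ℝ) 1) (θ : ℝ) :
    ‖fderiv ℝ ψ (polar r θ)‖ ^ 2
      = (A' r + C' r * cos (n * θ)) ^ 2 + (n * C r / r * sin (n * θ)) ^ 2 := by
  have hd : HasFDerivAt ψ (fderiv ℝ ψ (polar r θ)) (polar r θ) :=
    (h.contDiff.differentiable one_ne_zero _).hasFDerivAt
  have h1 : HasDerivAt (fun s => polar s θ) (cos θ • (EuclideanSpace.single 0 1 : E2)
      + sin θ • EuclideanSpace.single 1 1) r := by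
    simp_rw [polar_eq_smul]
    exact ((hasDerivAt_id r).smul_const _).congr_deriv (one_smul ℝ _)
  have h2 : HasDerivAt (fun τ => polar r τ) (r • ((-sin θ) • (EuclideanSpace.single 0 1 : E2)
      + cos θ • EuclideanSpace.single 1 1)) θ := by
    simp_rw [polar_eq_smul]
    exact (((hasDerivAt_cos θ).smul_const _).add ((hasDerivAt_sin θ).smul_const _)).const_smul r
  have h3 : fderiv ℝ ψ (polar r θ) (cos θ • (EuclideanSpace.single 0 1 : E2)
      + sin θ • EuclideanSpace.single 1 1) = A' r + C' r * cos (n * θ) := by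
    refine (hd.comp_hasDerivAt r h1).unique (((h.hasDerivAt_fst r hr).add
      ((h.hasDerivAt_snd r hr).mul_const (cos (n * θ)))).congr_of_eventuallyEq ?_)
    filter_upwards [Ioo_mem_nhds hr.1 hr.2] with s hs
    exact h.apply_polar s hs θ
  have h4 : fderiv ℝ ψ (polar r θ) (r • ((-sin θ) • (EuclideanSpace.single 0 1 : E2)
      + cos θ • EuclideanSpace.single 1 1)) = C r * (-sin (n * θ) * n) := by
    have h5 : HasDerivAt (fun τ : ℝ => A r + C r * cos (n * τ)) (C r * (-sin (n * θ) * n)) θ := by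
      have := (((hasDerivAt_id θ).const_mul (n : ℝ)).cos.const_mul (C r)).const_add (A r)
      simpa using this
    refine (hd.comp_hasDerivAt θ h2).unique (h5.congr_of_eventuallyEq ?_)
    exact Eventually.of_forall fun τ => h.apply_polar r hr τ
  rw [map_smul, smul_eq_mul] at h4
  have hr0 := hr.1.ne'
  rw [norm_sq_eq_polar _ θ, h3, eq_div_of_mul_eq hr0 ((mul_comm _ _).trans h4)]
  field_simp

/-- The radial density of the quadratic form at `A(r) + C(r) cos (n θ)`. -/
def modeDensity (α p : ℝ) (n : ℕ) (g A A' C C' : ℝ → ℝ) (r : ℝ) : ℝ :=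
  2 * π * (r * A' r ^ 2 - p * (r ^ (1 + α) * |g r| ^ (p - 1)) * A r ^ 2)
    + π * (r * C' r ^ 2 + n ^ 2 / r * C r ^ 2 - p * (r ^ (1 + α) * |g r| ^ (p - 1)) * C r ^ 2)

lemma IsCosMode.quadForm_eq {α p : ℝ} {n : ℕ} {u ψ : E2 → ℝ} {g A A' C C' : ℝ → ℝ}
    (hα : 0 ≤ α) (hp : 1 < p) (hn : 1 ≤ n) (hu : ContinuousOn u (closedBall 0 1))
    (hg : ∀ r ∈ Set.Ioo (0 : ℝ) 1, ∀ θ, u (polar r θ) = g r)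
    (h : IsCosMode n ψ A A' C C') :
    IntervalIntegrable (modeDensity α p n g A A' C C') volume 0 1 ∧
      quadForm α p u ψ = ∫ r in (0 : ℝ)..1, modeDensity α p n g A A' C C' r := by
  have hF1 : Continuous fun x => ‖fderiv ℝ ψ x‖ ^ 2 :=
    (h.contDiff.continuous_fderiv one_ne_zero).norm.pow 2
  have hF2 : ContinuousOn (fun x => ‖x‖ ^ α * |u x| ^ (p - 1) * ψ x ^ 2) (closedBall 0 1) :=
    ((continuous_norm.continuousOn.rpow_const fun _ _ => Or.inr hα).mul
      (hu.abs.rpow_const fun _ _ => Or.inr (by linarith))).mul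
      (h.contDiff.continuous.pow 2).continuousOn
  have hF : ContinuousOn (fun x => ‖fderiv ℝ ψ x‖ ^ 2
      - p * (‖x‖ ^ α * |u x| ^ (p - 1) * ψ x ^ 2)) (closedBall 0 1) :=
    hF1.continuousOn.sub (continuousOn_const.mul hF2)
  have hint : ∀ G : E2 → ℝ, ContinuousOn G (closedBall 0 1) → IntegrableOn G (ball 0 1) :=
    fun G hG => (hG.integrableOn_compact (isCompact_closedBall 0 1)).mono_set
      ball_subset_closedBall
  have hinner : ∀ r ∈ Set.Ioo (0 : ℝ) 1,
      ∫ θ in -π..π, r * (‖fderiv ℝ ψ (polar r θ)‖ ^ 2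
        - p * (‖polar r θ‖ ^ α * |u (polar r θ)| ^ (p - 1) * ψ (polar r θ) ^ 2))
      = modeDensity α p n g A A' C C' r := fun r hr => by
    simp_rw [h.norm_fderiv_sq hr, norm_polar hr.1.le, hg r hr, h.apply_polar r hr]
    simp_rw [show ∀ θ : ℝ, r * ((A' r + C' r * cos (n * θ)) ^ 2 + (n * C r / r * sin (n * θ)) ^ 2
        - p * (r ^ α * |g r| ^ (p - 1) * (A r + C r * cos (n * θ)) ^ 2))
      = r * (A' r + C' r * cos (n * θ)) ^ 2 + r * (n * C r / r * sin (n * θ)) ^ 2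
        - r * p * (r ^ α * |g r| ^ (p - 1)) * (A r + C r * cos (n * θ)) ^ 2 from
      fun θ => by ring]
    rw [intervalIntegral.integral_sub, intervalIntegral.integral_add,
      intervalIntegral.integral_const_mul, intervalIntegral.integral_const_mul,
      intervalIntegral.integral_const_mul, integral_add_mul_cos_sq hn, integral_add_mul_cos_sq hn,
      integral_mul_sin_sq hn, modeDensity, add_comm 1 α, rpow_add_one hr.1.ne']
    · have := hr.1.ne'
      field_simp
      ring
    all_goals exact Continuous.intervalIntegrable (by fun_prop) _ _
  have hae : ∀ᵐ r ∂volume, r ∈ Set.uIoc (0 : ℝ) 1 →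
      ∫ θ in -π..π, r * (‖fderiv ℝ ψ (polar r θ)‖ ^ 2
        - p * (‖polar r θ‖ ^ α * |u (polar r θ)| ^ (p - 1) * ψ (polar r θ) ^ 2))
      = modeDensity α p n g A A' C C' r := by
    filter_upwards [measure_eq_zero_iff_ae_notMem.1 (measure_singleton (1 : ℝ))] with r hr hr'
    rw [Set.uIoc_of_le zero_le_one] at hr'
    exact hinner r ⟨hr'.1, lt_of_le_of_ne hr'.2 hr⟩
  refine ⟨(intervalIntegrable_polar hF).congr_ae
    ((ae_restrict_iff' measurableSet_uIoc).2 hae), ?_⟩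
  rw [← intervalIntegral.integral_congr_ae hae, ← integral_ball_eq_polar hF, quadForm,
    integral_sub (hint _ hF1.continuousOn) ((hint _ hF2).const_mul p), integral_const_mul]

lemma integral_eq_integral_of_eq_zero_of_notMem_Icc {f : ℝ → ℝ} {a b A B : ℝ} (hA : A ≤ a)
    (hab : a ≤ b) (hB : b ≤ B) (hf : ∀ t ∈ Set.Icc A B, t ∉ Set.Icc a b → f t = 0) :
    ∫ t in A..B, f t = ∫ t in a..b, f t := by
  rw [intervalIntegral.integral_of_le (hA.trans (hab.trans hB)),
    intervalIntegral.integral_of_le hab, ← integral_Icc_eq_integral_Ioc,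
    ← integral_Icc_eq_integral_Ioc]
  exact setIntegral_eq_of_subset_of_forall_sdiff_eq_zero measurableSet_Icc
    (Set.Icc_subset_Icc hA hB) fun t ht => hf t ht.1 ht.2

lemma IsRadialHenonSol.exists_trunc_integral_neg {α p : ℝ} {g D : ℝ → ℝ} (hα : 0 ≤ α)
    (h : IsRadialHenonSol α p g D) (hp : 1 < p) {r₁ : ℝ} (hr₁ : r₁ ∈ Set.Ico (0 : ℝ) 1)
    (hpos : 0 < g r₁) :
    ∃ ε > 0, ∫ r in (0 : ℝ)..1, (r * (ramp ε (g r) * D r) ^ 2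
      - p * (r ^ (1 + α) * |g r| ^ (p - 1)) * trunc ε (g r) ^ 2) < 0 := by
  have hAc : ContinuousOn (fun r => r ^ (1 + α) * |g r| ^ (p - 1)) (Set.Icc 0 1) :=
    (Real.continuous_rpow_const (by positivity)).continuousOn.mul
      (h.continuousOn.abs.rpow_const fun _ _ => Or.inr (by linarith))
  have hA0 : ∀ r : ℝ, 0 ≤ r → 0 ≤ r ^ (1 + α) * |g r| ^ (p - 1) := fun r hr => by positivity
  obtain ⟨C₁, hC₁⟩ := isCompact_Icc.exists_bound_of_continuousOn hAc
  obtain ⟨C₂, hC₂⟩ := isCompact_Icc.exists_bound_of_continuousOn h.continuousOn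
  obtain ⟨v, hv, hv'⟩ : ∃ v ∈ Set.Ioi r₁, Set.Ioo r₁ v ⊆ {r | g r₁ / 2 < g r} := by
    refine (mem_nhdsGT_iff_exists_Ioo_subset' hr₁.2).1 ?_
    have h1 : ∀ᶠ r in 𝓝[Set.Icc 0 1] r₁, g r₁ / 2 < g r :=
      (h.continuousOn r₁ ⟨hr₁.1, hr₁.2.le⟩).eventually_const_lt (half_lt_self hpos)
    refine nhdsWithin_le_of_mem (mem_of_superset (Ioo_mem_nhdsGT hr₁.2) ?_) h1
    exact fun x hx => ⟨hr₁.1.trans hx.1.le, hx.2.le⟩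
  set w := min v 1 with hw
  have hrw : r₁ < w := lt_min hv hr₁.2
  have hw1 : w ≤ 1 := min_le_right _ _
  have hr0 : 0 ≤ r₁ := hr₁.1
  set a₀ := r₁ + (w - r₁) / 3 with ha₀
  set b₀ := r₁ + 2 * (w - r₁) / 3 with hb₀
  have hg : ∀ t ∈ Set.Icc a₀ b₀, g r₁ / 2 < g t := fun t ht =>
    hv' ⟨by linarith [ht.1], (show t < w by linarith [ht.2]).trans_le (min_le_left _ _)⟩
  have ha₀0 : 0 < a₀ := by linarith
  have hb₀1 : b₀ < 1 := by linarith
  obtain ⟨ε, hε, hmain⟩ := _root_.exists_trunc_integral_neg (y := g) (D := D)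
    (A := fun r => r ^ (1 + α) * |g r| ^ (p - 1))
    (W := fun r => (p - 1) * (r ^ (1 + α) * |g r| ^ (p - 1)))
    (R := 1) (C := max C₁ C₂) (κ := g r₁ / 6) (a₀ := a₀) (b₀ := b₀) (by linarith) ha₀0.le
    (by linarith) hb₀1 (fun t ht => by linarith [hg t ht])
    (fun t ht => (le_abs_self _).trans ((hC₁ t ⟨ht.1, ht.2.le⟩).trans (le_max_left _ _)))
    (fun t ht => (hC₂ t ⟨ht.1, ht.2.le⟩).trans (le_max_right _ _))
    (fun t ht => mul_nonneg (by linarith) (hA0 t ht.1))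
    (fun t ht => by
      have h1 : 0 < g t := (half_pos hpos).trans (hg t ⟨ht.1.le, ht.2⟩)
      have h2 : 0 < t := ha₀0.trans ht.1
      have h3 : 0 < p - 1 := by linarith
      positivity)
    ((continuousOn_const.mul hAc).mono (Set.Icc_subset_Icc ha₀0.le hb₀1.le))
  obtain ⟨s, hs, hs'⟩ : ∃ s ∈ Set.Iio (1 : ℝ), Set.Ioo s 1 ⊆ {r | g r < ε} := by
    refine (mem_nhdsLT_iff_exists_Ioo_subset' zero_lt_one).1 ?_
    have h1 : ∀ᶠ r in 𝓝[Set.Icc 0 1] 1, g r < ε :=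
      (h.continuousOn 1 ⟨zero_le_one, le_rfl⟩).eventually_lt_const (by rwa [h.eq_zero])
    refine nhdsWithin_le_of_mem (mem_of_superset (Ioo_mem_nhdsLT zero_lt_one) ?_) h1
    exact fun x hx => ⟨hx.1.le, hx.2.le⟩
  set b := (max s b₀ + 1) / 2 with hb
  have hm1 : max s b₀ < 1 := max_lt hs hb₀1
  have hb1 : b < 1 := by linarith
  have hbm : max s b₀ < b := by linarith
  have hbb₀ : b₀ < b := (le_max_right _ _).trans_lt hbm
  have hbs : s < b := (le_max_left _ _).trans_lt hbm
  have hsub : Set.Icc 0 b ⊆ Set.Icc 0 1 := Set.Icc_subset_Icc le_rfl hb1.le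
  refine ⟨ε, hε, ?_⟩
  rw [integral_eq_integral_of_eq_zero_of_notMem_Icc (a := 0) (b := b) le_rfl (by linarith) hb1.le]
  · refine lt_of_eq_of_lt ?_ (hmain 0 b le_rfl ha₀0.le hbb₀.le hb1 (h.continuousOn.mono hsub)
      (h.continuousOn_deriv.mono fun t ht => ⟨ht.1, ht.2.trans_lt hb1⟩) (hAc.mono hsub)
      ((continuousOn_const.mul hAc).mono hsub)
      (fun t ht => h.hasDerivAt t ⟨ht.1, ht.2.trans hb1⟩)
      (fun t ht => h.hasDerivAt_mul t ⟨ht.1, ht.2.trans hb1⟩) (Or.inl (zero_mul _))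
      (hs' ⟨hbs, hb1⟩).le)
    congr 1
    ext r
    ring
  · intro t ht ht'
    have ht1 : b < t := by
      by_contra! hcon
      exact ht' ⟨ht.1, hcon⟩
    have hgt : g t ≤ ε := by
      rcases ht.2.eq_or_lt with rfl | ht2
      · rw [h.eq_zero]
        exact hε.le
      · exact (hs' ⟨hbs.trans ht1, ht2⟩).le
    rw [trunc_of_le hε hgt, ramp_of_le hε hgt]
    ring

lemma integral_bessel_mode {α p c ν : ℝ} {n : ℕ} {g ψ : ℝ → ℝ} {a b : ℝ} (hα : 0 ≤ α)
    (hc : 0 < c) (hν : ν * (1 + α / 2) = n) (h0 : g 0 ≠ 0)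
    (hc2 : (c * (1 + α / 2)) ^ 2 = |g 0| ^ (p - 1)) (hp : 1 < p)
    (hg : ContinuousOn g (Set.Icc 0 1)) (hψ : ContDiff ℝ 1 ψ) (ha : 0 < a) (hab : a < b)
    (hbc : b < c) (hsupp : ∀ t ∉ Set.Icc a b, ψ t = 0) :
    ∫ r in (0 : ℝ)..1, (r * (deriv ψ (c * r ^ (1 + α / 2))
        * (c * ((1 + α / 2) * r ^ (1 + α / 2 - 1)))) ^ 2
        + n ^ 2 / r * ψ (c * r ^ (1 + α / 2)) ^ 2
        - p * (r ^ (1 + α) * |g r| ^ (p - 1)) * ψ (c * r ^ (1 + α / 2)) ^ 2)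
      = (1 + α / 2) * ∫ t in a..b, (t * deriv ψ t ^ 2 + ν ^ 2 / t * ψ t ^ 2
        - p * t * |g (scaledRadius α c t) / g 0| ^ (p - 1) * ψ t ^ 2) := by
  set γ := 1 + α / 2 with hγ
  have hγ0 : 0 < γ := by positivity
  have hsupp' : ∀ t ∉ Set.Icc a b, deriv ψ t = 0 := fun t ht => by
    have h1 : ψ =ᶠ[𝓝 t] fun _ => 0 := by
      filter_upwards [isClosed_Icc.isOpen_compl.mem_nhds ht] with s hs using hsupp s hs
    rw [h1.deriv_eq, deriv_const]
  have hra := scaledRadius_mem hα hc ⟨ha, hab.trans hbc⟩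
  have hrb := scaledRadius_mem hα hc ⟨ha.trans hab, hbc⟩
  have hinv : ∀ t, 0 ≤ t → c * scaledRadius α c t ^ γ = t := fun t ht => by
    rw [scaledRadius, rpow_inv_rpow (div_nonneg ht hc.le) hγ0.ne']
    field_simp
  have hmono : ∀ s t, 0 ≤ s → s ≤ t → scaledRadius α c s ≤ scaledRadius α c t :=
    fun s t hs hst => rpow_le_rpow (div_nonneg hs hc.le)
      ((div_le_div_iff_of_pos_right hc).2 hst) (by positivity)
  rw [integral_eq_integral_of_eq_zero_of_notMem_Icc (a := scaledRadius α c a)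
    (b := scaledRadius α c b) hra.1.le (hmono a b ha.le hab.le) hrb.2.le]
  swap
  · intro r hr hr'
    have hnot : c * r ^ γ ∉ Set.Icc a b := fun hmem => hr' <| by
      rw [← scaledRadius_mul_rpow hα hc hr.1]
      exact ⟨hmono _ _ ha.le hmem.1, hmono _ _ (ha.le.trans hmem.1) hmem.2⟩
    rw [hsupp _ hnot, hsupp' _ hnot]
    ring
  set G : ℝ → ℝ := fun t => t * deriv ψ t ^ 2 + ν ^ 2 / t * ψ t ^ 2
        - p * t * |g (scaledRadius α c t) / g 0| ^ (p - 1) * ψ t ^ 2 with hG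
  have hGc : ContinuousOn G (Set.Icc a b) := by
    have hψ' : Continuous (deriv ψ) := hψ.continuous_deriv le_rfl
    have h1 : ContinuousOn (fun t => g (scaledRadius α c t)) (Set.Icc a b) := by
      refine hg.comp ((Real.continuous_rpow_const (by positivity)).comp
        (continuous_id.div_const c)).continuousOn fun t ht => ?_
      exact Set.Ioo_subset_Icc_self
        (scaledRadius_mem hα hc ⟨ha.trans_le ht.1, ht.2.trans_lt hbc⟩)
    have h2 : ContinuousOn (fun t => |g (scaledRadius α c t) / g 0| ^ (p - 1)) (Set.Icc a b) :=
      (h1.div_const _).abs.rpow_const fun _ _ => Or.inr (by linarith)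
    have h3 : ContinuousOn (fun t => ν ^ 2 / t) (Set.Icc a b) :=
      continuousOn_const.div continuousOn_id fun t ht => (ha.trans_le ht.1).ne'
    have := hψ.continuous
    fun_prop
  have himg : ∀ r ∈ Set.Icc (scaledRadius α c a) (scaledRadius α c b),
      c * r ^ γ ∈ Set.Icc a b := fun r hr => by
    have hr0 := hra.1.le.trans hr.1
    rw [← hinv a ha.le, ← hinv b (ha.trans hab).le]
    exact ⟨by gcongr; exacts [hra.1.le, hr.1], by gcongr; exact hr.2⟩
  have hcv := intervalIntegral.integral_comp_mul_deriv'' (a := scaledRadius α c a)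
    (b := scaledRadius α c b) (f := fun r => c * r ^ γ) (f' := fun r => c * (γ * r ^ (γ - 1)))
    (g := G) ?_ ?_ ?_ ?_
  · simp only [hinv a ha.le, hinv b (ha.trans hab).le] at hcv
    rw [← hcv, ← intervalIntegral.integral_const_mul]
    refine intervalIntegral.integral_congr fun r hr => ?_
    rw [Set.uIcc_of_le (hmono a b ha.le hab.le)] at hr
    have hr0 : 0 < r := hra.1.trans_le hr.1
    have h1 : |g r / g 0| ^ (p - 1) * (c * γ) ^ 2 = |g r| ^ (p - 1) := by
      rw [hc2, abs_div, div_rpow (abs_nonneg _) (abs_nonneg _), div_mul_cancel₀]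
      exact (rpow_pos_of_pos (abs_pos.2 h0) _).ne'
    have h2 : r ^ (1 + α) = r ^ γ * r ^ γ / r := by
      rw [← rpow_add hr0, ← rpow_sub_one hr0.ne']
      congr 1
      rw [hγ]
      ring
    have h3 : r ^ γ ≠ 0 := (rpow_pos_of_pos hr0 _).ne'
    simp only [Function.comp, hG]
    rw [scaledRadius_mul_rpow hα hc hr0.le, ← h1, h2, rpow_sub_one hr0.ne', ← hν]
    field_simp
  · exact ((Real.continuous_rpow_const hγ0.le).const_mul c).continuousOn
  · intro r hr
    rw [min_eq_left (hmono a b ha.le hab.le)] at hr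
    exact ((Real.hasDerivAt_rpow_const (Or.inl (hra.1.trans hr.1).ne')).const_mul
      c).hasDerivWithinAt
  · rw [Set.uIcc_of_le (hmono a b ha.le hab.le)]
    exact continuousOn_const.mul (continuousOn_const.mul
      (continuousOn_id.rpow_const fun r hr => Or.inl (hra.1.trans_le hr.1).ne'))
  · rw [Set.uIcc_of_le (hmono a b ha.le hab.le)]
    exact hGc.mono (Set.image_subset_iff.2 himg)

lemma norm_reflX (q : E2) : ‖reflX q‖ = ‖q‖ := by
  simp [reflX, EuclideanSpace.norm_eq, Fin.sum_univ_two]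

lemma norm_rot2 (φ : ℝ) (q : E2) : ‖rot2 φ q‖ = ‖q‖ := by
  simp only [rot2, EuclideanSpace.norm_eq, Fin.sum_univ_two, Real.norm_eq_abs, sq_abs]
  congr 1
  simp
  linear_combination (q 0 ^ 2 + q 1 ^ 2) * sin_sq_add_cos_sq φ

/-- The `n`-invariant `C¹` functions with compact support in the open unit disc. -/
def testSpace (n : ℕ) : Submodule ℝ (E2 → ℝ) where
  carrier := {ψ | ContDiff ℝ 1 ψ ∧ HasCompactSupport ψ ∧ tsupport ψ ⊆ ball 0 1 ∧ nInvariant n ψ}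
  zero_mem' := ⟨contDiff_const, HasCompactSupport.zero, by simp [tsupport], by simp [nInvariant]⟩
  add_mem' := fun {f g} hf hg => ⟨hf.1.add hg.1, hf.2.1.add hg.2.1,
    (closure_minimal ((Function.support_add f g).trans (Set.union_subset_union
      (subset_tsupport f) (subset_tsupport g))) ((isClosed_tsupport f).union
      (isClosed_tsupport g))).trans (Set.union_subset hf.2.2.1 hg.2.2.1),
    fun q => by simp [hf.2.2.2.1 q, hg.2.2.2.1 q],
    fun q => by simp [hf.2.2.2.2 q, hg.2.2.2.2 q]⟩
  smul_mem' := fun c f hf => ⟨contDiff_const.smul hf.1, hf.2.1.smul_left,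
    (closure_mono (Function.support_const_smul_subset c f)).trans hf.2.2.1,
    fun q => by simp [hf.2.2.2.1 q], fun q => by simp [hf.2.2.2.2 q]⟩

lemma mem_testSpace_of_eq_zero_of_notMem {n : ℕ} {f : E2 → ℝ} {K : Set E2} (hK : IsCompact K)
    (hK1 : K ⊆ ball 0 1) (h0 : ∀ x ∉ K, f x = 0) (hd : ∀ x ∈ K, ContDiffAt ℝ 1 f x)
    (hn : nInvariant n f) : f ∈ testSpace n := by
  refine ⟨contDiff_iff_contDiffAt.2 fun x => ?_, HasCompactSupport.intro hK h0,
    (closure_minimal (fun x hx => ?_) hK.isClosed).trans hK1, hn⟩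
  · by_cases hx : x ∈ K
    · exact hd x hx
    · refine (contDiffAt_const (c := (0 : ℝ))).congr_of_eventuallyEq ?_
      filter_upwards [hK.isClosed.isOpen_compl.mem_nhds hx] with y hy using h0 y hy
  · by_contra hxK
    exact hx (h0 x hxK)

/-- The truncation of `u` at height `ε`, extended by zero outside the unit disc. -/
def truncDisc (ε : ℝ) (u : E2 → ℝ) (x : E2) : ℝ :=
  open Classical in if ‖x‖ < 1 then trunc ε (u x) else 0

lemma truncDisc_mem_testSpace {n : ℕ} {ε : ℝ} {u : E2 → ℝ} (hε : 0 < ε)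
    (hu : ContDiffOn ℝ 2 u (ball 0 1)) (hc : ContinuousOn u (closedBall 0 1))
    (h0 : ∀ x : E2, ‖x‖ = 1 → u x = 0) (hn : nInvariant n u) :
    truncDisc ε u ∈ testSpace n := by
  have hK : IsCompact (closedBall (0 : E2) 1 ∩ u ⁻¹' Set.Ici ε) :=
    (isCompact_closedBall 0 1).of_isClosed_subset
      (hc.preimage_isClosed_of_isClosed isClosed_closedBall isClosed_Ici) Set.inter_subset_left
  have hK1 : closedBall (0 : E2) 1 ∩ u ⁻¹' Set.Ici ε ⊆ ball 0 1 := fun x hx => by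
    have hx1 : ‖x‖ ≤ 1 := mem_closedBall_zero_iff.1 hx.1
    refine mem_ball_zero_iff.2 (lt_of_le_of_ne hx1 fun h => ?_)
    have := hx.2
    rw [Set.mem_preimage, h0 x h] at this
    exact hε.not_ge this
  refine mem_testSpace_of_eq_zero_of_notMem hK hK1 (fun x hx => ?_) (fun x hx => ?_)
    ⟨fun q => ?_, fun q => ?_⟩
  · by_cases hx1 : ‖x‖ < 1
    · rw [truncDisc, if_pos hx1]
      refine trunc_of_le hε (le_of_not_ge fun h => hx ⟨?_, h⟩)
      exact mem_closedBall_zero_iff.2 hx1.le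
    · rw [truncDisc, if_neg hx1]
  · have hxb := isOpen_ball.mem_nhds (hK1 hx)
    refine ((contDiff_trunc ε).contDiffAt.comp x
      ((hu.contDiffAt hxb).of_le (by norm_num))).congr_of_eventuallyEq ?_
    filter_upwards [hxb] with y hy
    rw [truncDisc, if_pos (mem_ball_zero_iff.1 hy), Function.comp]
  · simp only [truncDisc, norm_reflX, hn.1 q]
  · simp only [truncDisc, norm_rot2, hn.2 q]

lemma mk_cos_sin_pow (θ : ℝ) (n : ℕ) :
    (⟨cos θ, sin θ⟩ : ℂ) ^ n = ⟨cos (n * θ), sin (n * θ)⟩ := by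
  have h : ∀ φ : ℝ, (⟨cos φ, sin φ⟩ : ℂ) = Complex.cos φ + Complex.sin φ * Complex.I := fun φ => by
    rw [Complex.mk_eq_add_mul_I, Complex.ofReal_cos, Complex.ofReal_sin]
  rw [h, h, Complex.cos_add_sin_mul_I_pow, Complex.ofReal_mul, Complex.ofReal_natCast]

/-- The function `ψ(c r ^ γ) cos (n θ)` in polar coordinates `(r, θ)`. -/
def angularMode (c γ : ℝ) (n : ℕ) (ψ : ℝ → ℝ) (x : E2) : ℝ :=
  ψ (c * ‖x‖ ^ γ) / ‖x‖ ^ n * ((⟨x 0, x 1⟩ : ℂ) ^ n).re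

lemma angularMode_polar (c γ : ℝ) (n : ℕ) (ψ : ℝ → ℝ) {r : ℝ} (hr : 0 < r) (θ : ℝ) :
    angularMode c γ n ψ (polar r θ) = ψ (c * r ^ γ) * cos (n * θ) := by
  have h1 : (⟨polar r θ 0, polar r θ 1⟩ : ℂ) = (r : ℂ) * ⟨cos θ, sin θ⟩ := by
    apply Complex.ext <;> simp [polar]
  have h2 : ((⟨polar r θ 0, polar r θ 1⟩ : ℂ) ^ n).re = r ^ n * cos (n * θ) := by
    rw [h1, mul_pow, mk_cos_sin_pow, ← Complex.ofReal_pow, Complex.re_ofReal_mul]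
  rw [angularMode, h2, norm_polar hr.le]
  have := (pow_pos hr n).ne'
  field_simp

lemma nInvariant_angularMode (c γ : ℝ) {n : ℕ} (hn : 1 ≤ n) (ψ : ℝ → ℝ) :
    nInvariant n (angularMode c γ n ψ) := by
  refine ⟨fun q => ?_, fun q => ?_⟩
  · have h1 : (⟨reflX q 0, reflX q 1⟩ : ℂ) = (starRingEnd ℂ) ⟨q 0, q 1⟩ := by
      apply Complex.ext <;> simp [reflX]
    rw [angularMode, angularMode, norm_reflX, h1, ← map_pow, Complex.conj_re]
  · have h1 : (⟨rot2 (2 * π / n) q 0, rot2 (2 * π / n) q 1⟩ : ℂ)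
        = ⟨cos (2 * π / n), sin (2 * π / n)⟩ * ⟨q 0, q 1⟩ := by
      apply Complex.ext <;> simp [rot2]
      ring
    have h2 : (⟨cos (2 * π / n), sin (2 * π / n)⟩ : ℂ) ^ n = 1 := by
      have hn' : (n : ℝ) ≠ 0 := by positivity
      rw [mk_cos_sin_pow, mul_div_cancel₀ _ hn', cos_two_pi, sin_two_pi]
      rfl
    rw [angularMode, angularMode, norm_rot2, h1, mul_pow, h2, one_mul]

lemma angularMode_mem_testSpace {c γ a b : ℝ} {n : ℕ} {ψ : ℝ → ℝ} (hn : 1 ≤ n) (hc : 0 < c)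
    (hγ : 0 < γ) (hψ : ContDiff ℝ 1 ψ) (ha : 0 < a) (hbc : b < c)
    (hsupp : ∀ t ∉ Set.Icc a b, ψ t = 0) : angularMode c γ n ψ ∈ testSpace n := by
  have hcont : Continuous fun x : E2 => c * ‖x‖ ^ γ :=
    (continuous_norm.rpow_const fun _ => Or.inr hγ.le).const_mul c
  have hsub : (fun x : E2 => c * ‖x‖ ^ γ) ⁻¹' Set.Icc a b ⊆ ball 0 1 := fun x hx => by
    have h1 : c * ‖x‖ ^ γ < c * 1 := by linarith [hx.2]
    rw [mem_ball_zero_iff]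
    by_contra! h2
    exact (lt_of_mul_lt_mul_left h1 hc.le).not_ge (one_le_rpow h2 hγ.le)
  refine mem_testSpace_of_eq_zero_of_notMem (K := (fun x : E2 => c * ‖x‖ ^ γ) ⁻¹' Set.Icc a b)
    ((isCompact_closedBall 0 1).of_isClosed_subset (isClosed_Icc.preimage hcont)
      (hsub.trans ball_subset_closedBall)) hsub (fun x hx => ?_) (fun x hx => ?_)
    (nInvariant_angularMode c γ hn ψ)
  · rw [angularMode, hsupp _ hx, zero_div, zero_mul]
  · have hx0 : x ≠ 0 := by
      rintro rfl
      have := hx.1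
      simp only [norm_zero, zero_rpow hγ.ne', mul_zero] at this
      linarith
    have hnorm : ContDiffAt ℝ 1 (fun x : E2 => ‖x‖) x := contDiffAt_norm ℝ hx0
    have h1 : ContDiffAt ℝ 1 (fun x : E2 => ψ (c * ‖x‖ ^ γ)) x :=
      hψ.contDiffAt.comp x
        (contDiffAt_const.mul (hnorm.rpow_const_of_ne (norm_ne_zero_iff.2 hx0)))
    have h2 : ContDiff ℝ 1 fun x : E2 => ((⟨x 0, x 1⟩ : ℂ) ^ n).re := by
      have h3 : ∀ x : E2, ((⟨x 0, x 1⟩ : ℂ) ^ n).re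
          = Complex.reCLM ((Complex.ofRealCLM (x 0) + Complex.ofRealCLM (x 1) * Complex.I) ^ n) :=
        fun x => by
        rw [Complex.reCLM_apply, Complex.ofRealCLM_apply, Complex.ofRealCLM_apply,
          ← Complex.mk_eq_add_mul_I]
      simp_rw [h3]
      fun_prop
    exact (h1.div (hnorm.pow n) (pow_ne_zero _ (norm_ne_zero_iff.2 hx0))).mul h2.contDiffAt

lemma exists_negative_submodule {α p : ℝ} {n m : ℕ} {u : E2 → ℝ} {ψ : Fin m → E2 → ℝ}
    {q : Fin m → ℝ} (hψ : ∀ i, ψ i ∈ testSpace n) (hq : ∀ i, q i < 0)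
    (hsum : ∀ c : Fin m → ℝ, quadForm α p u (∑ i, c i • ψ i) = ∑ i, c i ^ 2 * q i) :
    ∃ V : Submodule ℝ (E2 → ℝ), Module.finrank ℝ V = m ∧ V ≤ testSpace n ∧
      ∀ φ ∈ V, φ ≠ 0 → quadForm α p u φ < 0 := by
  have hle : ∀ (c : Fin m → ℝ) (i : Fin m), c i ^ 2 * q i ≤ 0 := fun c i =>
    mul_nonpos_of_nonneg_of_nonpos (sq_nonneg _) (hq i).le
  have hneg : ∀ c : Fin m → ℝ, (∃ i, c i ≠ 0) → quadForm α p u (∑ i, c i • ψ i) < 0 := by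
    rintro c ⟨i, hi⟩
    rw [hsum]
    exact Finset.sum_neg' (fun i _ => hle c i)
      ⟨i, Finset.mem_univ i, mul_neg_of_pos_of_neg (by positivity) (hq i)⟩
  have hlin : LinearIndependent ℝ ψ := Fintype.linearIndependent_iff.2 fun c hc i => by
    by_contra hi
    have := hneg c ⟨i, hi⟩
    rw [hc] at this
    simp [quadForm, Pi.zero_def] at this
  refine ⟨Submodule.span ℝ (Set.range ψ), ?_, Submodule.span_le.2 ?_, fun φ hφ hφ0 => ?_⟩
  · rw [finrank_span_eq_card hlin, Fintype.card_fin]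
  · rintro _ ⟨i, rfl⟩
    exact hψ i
  · obtain ⟨c, rfl⟩ := (Submodule.mem_span_range_iff_exists_fun ℝ).1 hφ
    refine hneg c ?_
    by_contra! h
    exact hφ0 (by simp [h])

lemma isCosMode_truncDisc {n : ℕ} {ε s : ℝ} {u : E2 → ℝ} {g D : ℝ → ℝ}
    (hψ : truncDisc ε (fun x => s * u x) ∈ testSpace n)
    (hg : ∀ r ∈ Set.Ioo (0 : ℝ) 1, ∀ θ, u (polar r θ) = g r)
    (hd : ∀ r ∈ Set.Ioo (0 : ℝ) 1, HasDerivAt g (D r) r) :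
    IsCosMode n (truncDisc ε fun x => s * u x) (fun r => trunc ε (s * g r))
      (fun r => ramp ε (s * g r) * (s * D r)) (fun _ => 0) (fun _ => 0) where
  contDiff := hψ.1
  apply_polar r hr θ := by
    rw [truncDisc, norm_polar hr.1.le, if_pos hr.2, hg r hr, zero_mul, add_zero]
  hasDerivAt_fst r hr := (hasDerivAt_trunc ε _).comp r ((hd r hr).const_mul s)
  hasDerivAt_snd r _ := hasDerivAt_const r 0

lemma isCosMode_angularMode {c γ : ℝ} {n : ℕ} {ψ : ℝ → ℝ} (hψ : ContDiff ℝ 1 ψ)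
    (hmem : angularMode c γ n ψ ∈ testSpace n) :
    IsCosMode n (angularMode c γ n ψ) (fun _ => 0) (fun _ => 0) (fun r => ψ (c * r ^ γ))
      (fun r => deriv ψ (c * r ^ γ) * (c * (γ * r ^ (γ - 1)))) where
  contDiff := hmem.1
  apply_polar r hr θ := by rw [angularMode_polar c γ n ψ hr.1, zero_add]
  hasDerivAt_fst r _ := hasDerivAt_const r 0
  hasDerivAt_snd r hr := (hψ.differentiable one_ne_zero _).hasDerivAt.comp r
    ((Real.hasDerivAt_rpow_const (Or.inl hr.1.ne')).const_mul c)

lemma IsCosMode.combination {n : ℕ} {ψ₁ ψ₂ ψ₃ : E2 → ℝ} {A₁ A₁' A₂ A₂' C₃ C₃' : ℝ → ℝ}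
    (h₁ : IsCosMode n ψ₁ A₁ A₁' (fun _ => 0) (fun _ => 0))
    (h₂ : IsCosMode n ψ₂ A₂ A₂' (fun _ => 0) (fun _ => 0))
    (h₃ : IsCosMode n ψ₃ (fun _ => 0) (fun _ => 0) C₃ C₃') (c : Fin 3 → ℝ) :
    IsCosMode n (∑ i, c i • ![ψ₁, ψ₂, ψ₃] i) (fun r => c 0 * A₁ r + c 1 * A₂ r)
      (fun r => c 0 * A₁' r + c 1 * A₂' r) (fun r => c 2 * C₃ r) (fun r => c 2 * C₃' r) where
  contDiff := by
    have hs : (∑ i, c i • ![ψ₁, ψ₂, ψ₃] i) = c 0 • ψ₁ + c 1 • ψ₂ + c 2 • ψ₃ := by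
      simp [Fin.sum_univ_three]
    rw [hs]
    exact ((contDiff_const.smul h₁.contDiff).add (contDiff_const.smul h₂.contDiff)).add
      (contDiff_const.smul h₃.contDiff)
  apply_polar r hr θ := by
    simp [Fin.sum_univ_three, h₁.apply_polar r hr, h₂.apply_polar r hr, h₃.apply_polar r hr]
    ring
  hasDerivAt_fst r hr := ((h₁.hasDerivAt_fst r hr).const_mul _).add
    ((h₂.hasDerivAt_fst r hr).const_mul _)
  hasDerivAt_snd r hr := (h₃.hasDerivAt_snd r hr).const_mul _

lemma quadForm_combination {α p : ℝ} {n : ℕ} {u : E2 → ℝ} {g : ℝ → ℝ}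
    {ψ₁ ψ₂ ψ₃ : E2 → ℝ} {A₁ A₁' A₂ A₂' C₃ C₃' : ℝ → ℝ}
    (hα : 0 ≤ α) (hp : 1 < p) (hn : 1 ≤ n) (hu : ContinuousOn u (closedBall 0 1))
    (hg : ∀ r ∈ Set.Ioo (0 : ℝ) 1, ∀ θ, u (polar r θ) = g r)
    (h₁ : IsCosMode n ψ₁ A₁ A₁' (fun _ => 0) (fun _ => 0))
    (h₂ : IsCosMode n ψ₂ A₂ A₂' (fun _ => 0) (fun _ => 0))
    (h₃ : IsCosMode n ψ₃ (fun _ => 0) (fun _ => 0) C₃ C₃')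
    (hA : ∀ r, A₁ r * A₂ r = 0) (hA' : ∀ r, A₁' r * A₂' r = 0) (c : Fin 3 → ℝ) :
    quadForm α p u (∑ i, c i • ![ψ₁, ψ₂, ψ₃] i)
      = ∑ i, c i ^ 2 * quadForm α p u (![ψ₁, ψ₂, ψ₃] i) := by
  obtain ⟨i₁, e₁⟩ := h₁.quadForm_eq hα hp hn hu hg
  obtain ⟨i₂, e₂⟩ := h₂.quadForm_eq hα hp hn hu hg
  obtain ⟨i₃, e₃⟩ := h₃.quadForm_eq hα hp hn hu hg
  rw [((h₁.combination h₂ h₃ c).quadForm_eq hα hp hn hu hg).2, Fin.sum_univ_three]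
  simp only [Matrix.cons_val_zero, Matrix.cons_val_one, Matrix.cons_val]
  rw [e₁, e₂, e₃, ← intervalIntegral.integral_const_mul, ← intervalIntegral.integral_const_mul,
    ← intervalIntegral.integral_const_mul,
    ← intervalIntegral.integral_add (i₁.const_mul _) (i₂.const_mul _),
    ← intervalIntegral.integral_add ((i₁.const_mul _).add (i₂.const_mul _)) (i₃.const_mul _)]
  congr 1
  ext r
  simp only [modeDensity]
  linear_combination (4 * π * r * c 0 * c 1) * hA' r
    - (4 * π * p * (r ^ (1 + α) * |g r| ^ (p - 1)) * c 0 * c 1) * hA r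

lemma IsHenonSol.exists_negative_submodule_of_radial {α p c ν a b : ℝ} {n : ℕ} {u : E2 → ℝ}
    {ψ : ℝ → ℝ} (hα : 0 ≤ α) (hp : 1 < p) (hn : 1 ≤ n) (hu : IsHenonSol α p u)
    (hinv : nInvariant n u)
    (hrad : ∀ x ∈ closedBall (0 : E2) 1, u x = u (‖x‖ • EuclideanSpace.single 0 1))
    (hpos : ∃ x ∈ ball (0 : E2) 1, 0 < u x) (hneg : ∃ x ∈ ball (0 : E2) 1, u x < 0)
    (hc : 0 < c) (hc2 : (c * (1 + α / 2)) ^ 2 = |u 0| ^ (p - 1)) (hν : ν * (1 + α / 2) = n)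
    (hψ : ContDiff ℝ 1 ψ) (ha : 0 < a) (hab : a < b) (hbc : b < c)
    (hsupp : ∀ t ∉ Set.Icc a b, ψ t = 0) (h0 : u 0 ≠ 0)
    (hψneg : ∫ t in a..b, (t * deriv ψ t ^ 2 + ν ^ 2 / t * ψ t ^ 2 - p * t *
      |u (scaledRadius α c t • EuclideanSpace.single 0 1) / u 0| ^ (p - 1) * ψ t ^ 2) < 0) :
    ∃ V : Submodule ℝ (E2 → ℝ), Module.finrank ℝ V = 3 ∧ V ≤ testSpace n ∧
      ∀ φ ∈ V, φ ≠ 0 → quadForm α p u φ < 0 := by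
  set g : ℝ → ℝ := fun r => u (r • EuclideanSpace.single 0 1) with hg
  set D : ℝ → ℝ := fun r => fderiv ℝ u (r • EuclideanSpace.single 0 1)
    (EuclideanSpace.single 0 1) with hD
  have hode : IsRadialHenonSol α p g D := hu.isRadialHenonSol hrad
  have hg0 : g 0 = u 0 := by simp [hg]
  have hpolar : ∀ r ∈ Set.Ioo (0 : ℝ) 1, ∀ θ, u (polar r θ) = g r := fun r hr θ => by
    rw [hrad _ (by rw [mem_closedBall_zero_iff, norm_polar hr.1.le]; exact hr.2.le),
      norm_polar hr.1.le]
  have hmem : ∀ s ε : ℝ, 0 < ε → truncDisc ε (fun x => s * u x) ∈ testSpace n := fun s ε hε =>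
    truncDisc_mem_testSpace hε (contDiffOn_const.mul hu.1) (continuousOn_const.mul hu.2.1)
      (fun x hx => by rw [hu.2.2.2 x hx, mul_zero])
      ⟨fun q => by simp only [hinv.1 q], fun q => by simp only [hinv.2 q]⟩
  obtain ⟨ε₁, hε₁, hq₁⟩ : ∃ ε > 0, ∫ r in (0 : ℝ)..1, (r * (ramp ε (1 * g r) * (1 * D r)) ^ 2
      - p * (r ^ (1 + α) * |g r| ^ (p - 1)) * trunc ε (1 * g r) ^ 2) < 0 := by
    obtain ⟨x, hx, hx0⟩ := hpos
    rw [hrad x (ball_subset_closedBall hx)] at hx0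
    simpa only [one_mul] using
      hode.exists_trunc_integral_neg hα hp ⟨norm_nonneg x, mem_ball_zero_iff.1 hx⟩ hx0
  obtain ⟨ε₂, hε₂, hq₂⟩ : ∃ ε > 0, ∫ r in (0 : ℝ)..1, (r * (ramp ε (-1 * g r) * (-1 * D r)) ^ 2
      - p * (r ^ (1 + α) * |g r| ^ (p - 1)) * trunc ε (-1 * g r) ^ 2) < 0 := by
    obtain ⟨x, hx, hx0⟩ := hneg
    rw [hrad x (ball_subset_closedBall hx)] at hx0
    have := hode.neg.exists_trunc_integral_neg hα hp ⟨norm_nonneg x, mem_ball_zero_iff.1 hx⟩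
      (neg_pos.2 hx0)
    simpa only [neg_one_mul, abs_neg] using this
  have hmem₃ : angularMode c (1 + α / 2) n ψ ∈ testSpace n :=
    angularMode_mem_testSpace hn hc (by positivity) hψ ha hbc hsupp
  have h₁ := isCosMode_truncDisc (hmem 1 ε₁ hε₁) hpolar hode.hasDerivAt
  have h₂ := isCosMode_truncDisc (hmem (-1) ε₂ hε₂) hpolar hode.hasDerivAt
  have h₃ := isCosMode_angularMode hψ hmem₃
  have hdisj : ∀ r, 1 * g r ≤ ε₁ ∨ -1 * g r ≤ ε₂ := fun r => by
    rcases le_total (g r) 0 with h | h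
    · exact Or.inl (by linarith)
    · exact Or.inr (by linarith)
  refine exists_negative_submodule (ψ := ![_, _, _]) ?_ ?_
    (quadForm_combination hα hp hn hu.2.1 hpolar h₁ h₂ h₃ (fun r => ?_) fun r => ?_)
  · intro i
    fin_cases i
    exacts [hmem 1 ε₁ hε₁, hmem (-1) ε₂ hε₂, hmem₃]
  · intro i
    fin_cases i
    · refine ((h₁.quadForm_eq hα hp hn hu.2.1 hpolar).2).trans_lt ?_
      simp only [modeDensity]
      simp only [ne_eq, OfNat.ofNat_ne_zero, not_false_eq_true, zero_pow, mul_zero, add_zero,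
        sub_zero, intervalIntegral.integral_const_mul]
      exact mul_neg_of_pos_of_neg two_pi_pos hq₁
    · refine ((h₂.quadForm_eq hα hp hn hu.2.1 hpolar).2).trans_lt ?_
      simp only [modeDensity]
      simp only [ne_eq, OfNat.ofNat_ne_zero, not_false_eq_true, zero_pow, mul_zero, add_zero,
        sub_zero, intervalIntegral.integral_const_mul]
      exact mul_neg_of_pos_of_neg two_pi_pos hq₂
    · refine ((h₃.quadForm_eq hα hp hn hu.2.1 hpolar).2).trans_lt ?_
      simp only [modeDensity]
      simp only [ne_eq, OfNat.ofNat_ne_zero, not_false_eq_true, zero_pow, mul_zero, zero_add,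
        sub_zero, intervalIntegral.integral_const_mul]
      refine mul_neg_of_pos_of_neg pi_pos ?_
      rw [← hg0] at hc2 h0 hψneg
      rw [integral_bessel_mode hα hc hν h0 hc2 hp hode.continuousOn hψ ha hab hbc hsupp]
      exact mul_neg_of_pos_of_neg (by positivity) hψneg
  · rcases hdisj r with h | h
    · simp only [trunc_of_le hε₁ h, zero_mul]
    · simp only [trunc_of_le hε₂ h, mul_zero]
  · rcases hdisj r with h | h
    · simp only [ramp_of_le hε₁ h, zero_mul]
    · simp only [ramp_of_le hε₂ h, zero_mul, mul_zero]

/-- if `n < (2+α)β/2` (where `z_1(β) = z_2(0)`), then for `p` close to 1 the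
least energy `n`-invariant nodal solutions are not radial. -/
theorem stmt_17 (α : ℝ) (hα : 0 ≤ α) (n : ℕ) (hn : 1 ≤ n)
    (β : ℝ) (hβ : 0 < β) (z20 : ℝ) (hz20 : IsNthZero 0 2 z20) (hβz : IsNthZero β 1 z20)
    (hsmall : (n : ℝ) < (2 + α) * β / 2)
    (p0 : ℝ) (hp0 : 1 < p0) (U : ℝ → E2 → ℝ)
    (hU : ∀ p ∈ Set.Ioo (1 : ℝ) p0, IsLeastEnergyNInvNodal α p n (U p)) :
    ∃ pbar ∈ Set.Ioc (1 : ℝ) p0, ∀ p ∈ Set.Ioo (1 : ℝ) pbar,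
      ¬ ∃ g : ℝ → ℝ, ∀ x ∈ closedBall (0 : E2) 1, U p x = g ‖x‖ := by
  have hγ : 0 < 1 + α / 2 := by positivity
  set ν := n / (1 + α / 2) with hν
  have hνβ : ν < β := by
    rw [hν, div_lt_iff₀ hγ]
    linarith
  obtain ⟨ψ, a, b, hψ, ha, hab, hbz, hsupp, hneg⟩ :=
    exists_bessel_test_function hβ (by positivity : 0 ≤ ν) hνβ hβz
  obtain ⟨q, hq, hq'⟩ := (mem_nhdsGT_iff_exists_Ioo_subset' hp0).1
    (eventually_test_function_neg hz20 hψ ha hab hbz hneg)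
  refine ⟨min q p0, ⟨lt_min hq hp0, min_le_right _ _⟩, ?_⟩
  rintro p ⟨hp, hpq⟩ ⟨h, hh⟩
  obtain ⟨hsol, hinv, hpos, hneg', hmorse, -⟩ := hU p ⟨hp, hpq.trans_le (min_le_right _ _)⟩
  have hrad : ∀ x ∈ closedBall (0 : E2) 1,
      U p x = U p (‖x‖ • EuclideanSpace.single 0 1) := fun x hx => by
    have h1 : ‖‖x‖ • (EuclideanSpace.single 0 1 : E2)‖ = ‖x‖ :=
      norm_smul_single_zero (norm_nonneg x)
    rw [hh x hx, hh _ (by rwa [mem_closedBall_zero_iff, h1, ← mem_closedBall_zero_iff]), h1]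
  have hode := hsol.isRadialHenonSol hrad
  have h0 : U p 0 ≠ 0 := fun h0 => by
    obtain ⟨x, hx, hx0⟩ := hpos
    have hx' : x ≠ 0 := by
      rintro rfl
      exact hx0.ne' h0
    have h1 := hode.abs_le hα hp ⟨norm_pos_iff.2 hx', mem_ball_zero_iff.1 hx⟩
    rw [← hrad x (ball_subset_closedBall hx), zero_smul, h0, abs_zero] at h1
    exact hx0.ne' (abs_nonpos_iff.1 h1)
  have hM : 0 < |U p 0| ^ (p - 1) := rpow_pos_of_pos (abs_pos.2 h0) _
  set c := √(|U p 0| ^ (p - 1)) / (1 + α / 2) with hc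
  have hc0 : 0 < c := div_pos (sqrt_pos.2 hM) hγ
  have hc2 : (c * (1 + α / 2)) ^ 2 = |U p 0| ^ (p - 1) := by
    rw [hc, div_mul_cancel₀ _ hγ.ne', sq_sqrt hM.le]
  have hprof := hode.isRadialProfile hα hp (by simpa using h0) hc0 (by simpa using hc2)
  have hzero : ∃ t ∈ Set.Ioo 0 c, U p (scaledRadius α c t • EuclideanSpace.single 0 1)
      / U p ((0 : ℝ) • EuclideanSpace.single 0 1) = 0 := by
    obtain ⟨x, hx, hx0⟩ := hpos
    obtain ⟨y, hy, hy0⟩ := hneg'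
    rw [hrad x (ball_subset_closedBall hx)] at hx0
    rw [hrad y (ball_subset_closedBall hy)] at hy0
    obtain ⟨r, hr, hr0⟩ := (Set.ordConnected_Ico.isPreconnected).intermediate_value
      (show ‖y‖ ∈ Set.Ico (0 : ℝ) 1 from ⟨norm_nonneg y, mem_ball_zero_iff.1 hy⟩)
      (show ‖x‖ ∈ Set.Ico (0 : ℝ) 1 from ⟨norm_nonneg x, mem_ball_zero_iff.1 hx⟩)
      (hode.continuousOn.mono Set.Ico_subset_Icc_self) ⟨hy0.le, hx0.le⟩
    replace hr0 : U p (r • EuclideanSpace.single 0 1) = 0 := hr0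
    have hr1 : 0 < r := by
      refine lt_of_le_of_ne hr.1 ?_
      rintro rfl
      rw [zero_smul] at hr0
      exact h0 hr0
    refine ⟨c * r ^ (1 + α / 2), ⟨by positivity, ?_⟩, ?_⟩
    · exact mul_lt_of_lt_one_right hc0 (rpow_lt_one hr.1 hr.2 hγ)
    · rw [scaledRadius_mul_rpow hα hc0 hr.1, hr0, zero_div]
  obtain ⟨hbc, hψneg⟩ := hq' ⟨hp, hpq.trans_le (min_le_left _ _)⟩ c _ _ hprof hzero
  simp only [zero_smul] at hψneg
  obtain ⟨V, hV, hVt, hVneg⟩ := hsol.exists_negative_submodule_of_radial hα hp hn hinv hrad hpos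
    hneg' hc0 hc2 (div_mul_cancel₀ _ hγ.ne') hψ ha hab hbc hsupp h0 hψneg
  have : 3 ≤ 2 := hmorse.2 ⟨V, hV, fun φ hφ => hVt hφ, hVneg⟩
  omega
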